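/- arXiv:2602.09966 — 2 statements merged into one kernel-verified Lean document; each statement's English description precedes it below -/
import Mathlib

section
/- Let X : f = 0 be a reduced surface of degree d ≥ 3 in P³ whose Jacobian algebra M(f) admits a graded free resolution 0 → ⊕_{k=1}^{r} S(1−d−b_k) → ⊕_{j=1}^{q} S(1−d−c_j) → ⊕_{i=1}^{p} S(1−d−d_i) → S(1−d)^4 → S → M(f) → 0, and suppose the singular subscheme Σ of X is 1-dimensional, i.e., the Hilbert polynomial P(M(f)) has degree exactly 1. Then P(M(f))(u) = (A/2)·u − B, where A = (d−1)² + Σ_{i=1}^{p} d_i² − Σ_{j=1}^{q} c_j² + Σ_{k=1}^{r} b_k² and B = (d(d−3)² − 4)/3 + ((d−3)/2)·(Σ_{i=1}^{p} d_i² − Σ_{j=1}^{q} c_j² + Σ_{k=1}^{r} b_k²) + (1/6)·(Σ_{i=1}^{p} d_i³ − Σ_{j=1}^{q} c_j³ + Σ_{k=1}^{r} b_k³). -/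
open MvPolynomial

noncomputable section

abbrev S4 : Type := MvPolynomial (Fin 4) ℂ

/-- `g` is homogeneous of integer degree `δ`: either `g = 0` or `δ ≥ 0` and `g` homogeneous. -/
def HomogZ (g : S4) (δ : ℤ) : Prop :=
  g = 0 ∨ (0 ≤ δ ∧ g.IsHomogeneous δ.toNat)

/-- The map `S^4 → S` given by the partial derivatives of `f`; its image is the Jacobian ideal. -/
def jacMap (f : S4) : (Fin 4 → S4) →ₗ[S4] S4 where
  toFun v := ∑ i, v i * pderiv i f
  map_add' a b := by simp [add_mul, Finset.sum_add_distrib]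
  map_smul' c a := by simp [Finset.mul_sum, mul_assoc]

/-- The Jacobian ideal of `f`. -/
def jacIdeal (f : S4) : Ideal S4 := Ideal.span (Set.range fun i => pderiv i f)

/-- Hilbert function of the Jacobian algebra `M(f) = S/J_f`: the dimension of its
degree `n` homogeneous component. -/
def hilb (f : S4) (n : ℕ) : ℕ :=
  Module.finrank ℂ
    ((homogeneousSubmodule (Fin 4) ℂ n) ⧸
      (Submodule.comap (homogeneousSubmodule (Fin 4) ℂ n).subtype
        (Submodule.restrictScalars ℂ (jacIdeal f))))

/-- The singular locus of the surface `X : f = 0` in `P³`. -/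
def singLocus (f : S4) : Set (Projectivization ℂ (Fin 4 → ℂ)) :=
  {P | ∀ i, eval P.rep (pderiv i f) = 0}

/-- A graded free resolution of `M(f)` of the shape (res2A). -/
structure JacRes (f : S4) {p q r : ℕ}
    (dd : Fin p → ℕ) (cc : Fin q → ℕ) (bb : Fin r → ℕ) where
  M1 : Matrix (Fin 4) (Fin p) S4
  M2 : Matrix (Fin p) (Fin q) S4
  M3 : Matrix (Fin q) (Fin r) S4
  hM1 : ∀ i a, (M1 i a).IsHomogeneous (dd a)
  hM2 : ∀ a b, HomogZ (M2 a b) ((cc b : ℤ) - (dd a : ℤ))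
  hM3 : ∀ b c, HomogZ (M3 b c) ((bb c : ℤ) - (cc b : ℤ))
  inj : Function.Injective M3.mulVecLin
  ex2 : LinearMap.range M3.mulVecLin = LinearMap.ker M2.mulVecLin
  ex1 : LinearMap.range M2.mulVecLin = LinearMap.ker M1.mulVecLin
  ex0 : LinearMap.range M1.mulVecLin = LinearMap.ker (jacMap f)

/-- Minimality of a resolution: all matrix entries lie in the irrelevant maximal ideal. -/
def JacRes.Minimal {f : S4} {p q r : ℕ} {dd : Fin p → ℕ} {cc : Fin q → ℕ} {bb : Fin r → ℕ}
    (R : JacRes f dd cc bb) : Prop :=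
  (∀ i a, constantCoeff (R.M1 i a) = 0) ∧ (∀ a b, constantCoeff (R.M2 a b) = 0) ∧
    (∀ b c, constantCoeff (R.M3 b c) = 0)


attribute [local instance] MvPolynomial.gradedAlgebra

theorem finrank_homog (n : ℕ) :
    Module.finrank ℂ (homogeneousSubmodule (Fin 4) ℂ n) = (n + 3).choose 3 := by
  have hli : LinearIndependent ℂ (fun s : Sym (Fin 4) n =>
      (monomial (Sym.equivNatSum (Fin 4) n s : Fin 4 →₀ ℕ) (1 : ℂ) : S4)) := by
    have := (basisMonomials (Fin 4) ℂ).linearIndependent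
    have h2 := this.comp (fun s : Sym (Fin 4) n => (Sym.equivNatSum (Fin 4) n s : Fin 4 →₀ ℕ))
      (Subtype.val_injective.comp (Equiv.injective _))
    simpa [Function.comp_def] using h2
  have hsp : homogeneousSubmodule (Fin 4) ℂ n = Submodule.span ℂ (Set.range (fun s : Sym (Fin 4) n =>
      (monomial (Sym.equivNatSum (Fin 4) n s : Fin 4 →₀ ℕ) (1 : ℂ) : S4))) := by
    rw [homogeneousSubmodule_eq_finsupp_supported, AddMonoidAlgebra.supported_eq_span_single]
    congr 1
    ext x
    constructor
    · rintro ⟨P, hP, rfl⟩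
      refine ⟨(Sym.equivNatSum (Fin 4) n).symm ⟨P, ?_⟩, ?_⟩
      · simpa [Finsupp.degree_apply, Finsupp.sum] using hP
      · simp only [Equiv.apply_symm_apply]; rfl
    · rintro ⟨s, rfl⟩
      refine ⟨_, ?_, rfl⟩
      have := (Sym.equivNatSum (Fin 4) n s).2
      simpa [Finsupp.degree_apply, Finsupp.sum] using this
  rw [hsp, finrank_span_eq_card hli, Sym.card_sym_eq_choose]
  simp only [Fintype.card_fin]
  rw [show 4 + n - 1 = n + 3 by omega]
  exact (Nat.choose_symm_add (a := n) (b := 3))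

instance finhomog (n : ℕ) : FiniteDimensional ℂ (homogeneousSubmodule (Fin 4) ℂ n) :=
  Module.Finite.iff_fg.mpr (homogeneousSubmodule_fg _ _ n)

theorem comp_mul {a x : S4} {k m n : ℕ} (ha : a.IsHomogeneous k) (h : k + m = n) :
    homogeneousComponent n (a * x) = a * homogeneousComponent m x := by
  subst h
  have := DirectSum.coe_decompose_mul_add_of_left_mem (homogeneousSubmodule (Fin 4) ℂ) (i := k) (j := m) (a := a) (b := x) ha
  rw [← decomposition.decompose'_apply, ← decomposition.decompose'_apply]
  exact this

/-- graded piece of a free module -/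
def gp {m : ℕ} (w : Fin m → ℕ) (n : ℕ) : Submodule ℂ (Fin m → S4) :=
  Submodule.pi Set.univ (fun i => homogeneousSubmodule (Fin 4) ℂ (n - w i))

theorem mem_gp {m : ℕ} (w : Fin m → ℕ) (n : ℕ) (v : Fin m → S4) :
    v ∈ gp w n ↔ ∀ i, (v i).IsHomogeneous (n - w i) := by
  simp [gp, Submodule.mem_pi]

def gpEquiv {m : ℕ} (w : Fin m → ℕ) (n : ℕ) :
    gp w n ≃ₗ[ℂ] ((i : Fin m) → homogeneousSubmodule (Fin 4) ℂ (n - w i)) where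
  toFun v i := ⟨v.1 i, (mem_gp w n v.1).1 v.2 i⟩
  invFun v := ⟨fun i => (v i).1, (mem_gp w n _).2 fun i => (v i).2⟩
  map_add' _ _ := rfl
  map_smul' _ _ := rfl
  left_inv _ := rfl
  right_inv _ := rfl

instance fingp {m : ℕ} (w : Fin m → ℕ) (n : ℕ) : FiniteDimensional ℂ (gp w n) :=
  Module.Finite.equiv (gpEquiv w n).symm

theorem finrank_gp {m : ℕ} (w : Fin m → ℕ) (n : ℕ) :
    Module.finrank ℂ (gp w n) = ∑ i, (n - w i + 3).choose 3 := by
  rw [(gpEquiv w n).finrank_eq, Module.finrank_pi_fintype]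
  simp [finrank_homog]

theorem comp_mulVec {a b : ℕ} (w : Fin a → ℕ) (w' : Fin b → ℕ) (M : Matrix (Fin b) (Fin a) S4)
    (hM : ∀ i j, HomogZ (M i j) ((w j : ℤ) - w' i)) (n : ℕ) (hw : ∀ j, w j ≤ n) (x : Fin a → S4) (i : Fin b) :
    homogeneousComponent (n - w' i) (M.mulVec x i) =
      M.mulVec (fun j => homogeneousComponent (n - w j) (x j)) i := by
  simp only [Matrix.mulVec, dotProduct, map_sum]
  refine Finset.sum_congr rfl fun j _ => ?_
  rcases hM i j with h | ⟨h0, h⟩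
  · simp [h]
  · apply comp_mul h
    have := hw j
    omega

theorem map_gp {a b : ℕ} (w : Fin a → ℕ) (w' : Fin b → ℕ) (M : Matrix (Fin b) (Fin a) S4)
    (hM : ∀ i j, HomogZ (M i j) ((w j : ℤ) - w' i)) (n : ℕ) (hw : ∀ j, w j ≤ n) :
    (gp w n).map (M.mulVecLin.restrictScalars ℂ) =
      (LinearMap.range M.mulVecLin).restrictScalars ℂ ⊓ gp w' n := by
  ext y
  simp only [Submodule.mem_map, Submodule.mem_inf, Submodule.restrictScalars_mem,
    LinearMap.mem_range, LinearMap.restrictScalars_apply, Matrix.mulVecLin_apply, mem_gp]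
  constructor
  · rintro ⟨x, hx, rfl⟩
    refine ⟨⟨x, rfl⟩, fun i => ?_⟩
    have h := comp_mulVec w w' M hM n hw x i
    have hx' : (fun j => homogeneousComponent (n - w j) (x j)) = x :=
      funext fun j => homogeneousComponent_eq_self (hx j)
    rw [hx'] at h
    rw [← h]
    exact homogeneousComponent_isHomogeneous _ _
  · rintro ⟨⟨x, rfl⟩, hy⟩
    refine ⟨fun j => homogeneousComponent (n - w j) (x j),
      fun j => homogeneousComponent_isHomogeneous _ _, ?_⟩
    funext i
    rw [← comp_mulVec w w' M hM n hw x i]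
    exact homogeneousComponent_eq_self (hy i)

theorem count {a b : ℕ} (w : Fin a → ℕ) (w' : Fin b → ℕ) (M : Matrix (Fin b) (Fin a) S4)
    (hM : ∀ i j, HomogZ (M i j) ((w j : ℤ) - w' i)) (n : ℕ) (hw : ∀ j, w j ≤ n) :
    Module.finrank ℂ ((LinearMap.range M.mulVecLin).restrictScalars ℂ ⊓ gp w' n : Submodule ℂ _) +
    Module.finrank ℂ ((LinearMap.ker M.mulVecLin).restrictScalars ℂ ⊓ gp w n : Submodule ℂ _)
     = ∑ i, (n - w i + 3).choose 3 := by
  rw [← finrank_gp, ← map_gp w w' M hM n hw]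
  rw [← LinearMap.finrank_range_add_finrank_ker ((M.mulVecLin.restrictScalars ℂ).domRestrict (gp w n))]
  rw [LinearMap.range_domRestrict]
  congr 1
  refine LinearEquiv.finrank_eq ?_
  exact
    { toFun := fun x => ⟨⟨x.1, x.2.2⟩, x.2.1⟩
      invFun := fun x => ⟨x.1.1, ⟨x.2, x.1.2⟩⟩
      map_add' := fun _ _ => rfl
      map_smul' := fun _ _ => rfl
      left_inv := fun _ => rfl
      right_inv := fun _ => rfl }

def M0 (f : S4) : Matrix (Fin 1) (Fin 4) S4 := fun _ j => pderiv j f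

theorem ker_M0 (f : S4) : LinearMap.ker (M0 f).mulVecLin = LinearMap.ker (jacMap f) := by
  ext v
  simp only [LinearMap.mem_ker, funext_iff]
  simp [M0, jacMap, Matrix.mulVec, dotProduct, mul_comm]

theorem hilb_eq (f : S4) (n : ℕ) :
    hilb f n + Module.finrank ℂ ((LinearMap.range (M0 f).mulVecLin).restrictScalars ℂ ⊓
      gp (fun _ => 0) n : Submodule ℂ _) = (n + 3).choose 3 := by
  rw [← finrank_homog, hilb]
  rw [← Submodule.finrank_quotient_add_finrank (Submodule.comap (homogeneousSubmodule (Fin 4) ℂ n).subtype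
        (Submodule.restrictScalars ℂ (jacIdeal f)))]
  congr 1
  have key : ∀ y : Fin 1 → S4, y ∈ LinearMap.range (M0 f).mulVecLin ↔ y 0 ∈ jacIdeal f := by
    intro y
    rw [jacIdeal, Ideal.mem_span_range_iff_exists_fun, LinearMap.mem_range]
    refine exists_congr fun c => ?_
    rw [funext_iff]
    simp [M0, Matrix.mulVec, dotProduct, mul_comm]
  refine LinearEquiv.finrank_eq ?_
  exact
    { toFun := fun x => ⟨⟨x.1 0, by simpa using (mem_gp _ _ _).1 x.2.2 0⟩, (key _).1 x.2.1⟩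
      invFun := fun x => ⟨fun _ => x.1.1, ⟨(key _).2 x.2, (mem_gp _ _ _).2 fun _ => x.1.2⟩⟩
      map_add' := fun _ _ => rfl
      map_smul' := fun _ _ => rfl
      left_inv := fun x => by ext1; funext i; fin_cases i; rfl
      right_inv := fun _ => rfl }

theorem choose3 (m : ℕ) : (((m + 3).choose 3 : ℕ) : ℚ) = ((m:ℚ)+3)*(m+2)*(m+1)/6 := by
  rw [Nat.cast_choose_eq_ascPochhammer_div]
  simp [ascPochhammer_succ_right, Nat.factorial]
  ring

theorem sumchoose {m : ℕ} (w : Fin m → ℕ) (d n : ℕ) (hd : 1 ≤ d) (h : ∀ i, w i + (d - 1) ≤ n) :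
    ((∑ i, (n - (w i + (d - 1)) + 3).choose 3 : ℕ) : ℚ) =
      (m * (((n : ℚ) + 3 - d) ^ 3 - (n + 3 - d)) - (3 * (n + 3 - d) ^ 2 - 1) * ∑ i, (w i : ℚ)
        + 3 * (n + 3 - d) * ∑ i, (w i : ℚ) ^ 2 - ∑ i, (w i : ℚ) ^ 3) / 6 := by
  have hm : (m : ℚ) * (((n : ℚ) + 3 - d) ^ 3 - (n + 3 - d)) =
     ∑ i : Fin m, (((n : ℚ) + 3 - d) ^ 3 - (n + 3 - d)) := by simp; ring
  rw [hm, Finset.mul_sum, Finset.mul_sum, ← Finset.sum_sub_distrib, ← Finset.sum_add_distrib, ← Finset.sum_sub_distrib,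
    Finset.sum_div, Nat.cast_sum]
  refine Finset.sum_congr rfl fun i _ => ?_
  rw [choose3, Nat.cast_sub (h i), Nat.cast_add, Nat.cast_sub hd]
  push_cast
  ring

theorem cubic_zero (a b c e : ℚ) (N : ℕ)
    (h : ∀ k : ℕ, N ≤ k → a * (k:ℚ) ^ 3 + b * (k:ℚ) ^ 2 + c * k + e = 0) : a = 0 ∧ b = 0 := by
  have h0 := h N le_rfl
  have h1 := h (N+1) (by omega)
  have h2 := h (N+2) (by omega)
  have h3 := h (N+3) (by omega)
  push_cast at h1 h2 h3
  have ha : a = 0 := by linear_combination (h3 - 3 * h2 + 3 * h1 - h0) / 6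
  refine ⟨ha, ?_⟩
  subst ha
  linear_combination (h2 - 2 * h1 + h0) / 2

/-- Theorem 1 (4): if the singular subscheme of `X` is 1-dimensional,
i.e. the Hilbert polynomial of `M(f)` has degree exactly `1`, then
`P(M(f))(u) = (A/2)·u − B` with `A` and `B` as in Theorem 1 (4). -/
theorem stmt4 (f : S4) (d : ℕ) (hd : 3 ≤ d) (hhom : f.IsHomogeneous d) (hred : Squarefree f)
    (p q r : ℕ) (hp : 3 ≤ p)
    (dd : Fin p → ℕ) (cc : Fin q → ℕ) (bb : Fin r → ℕ)
    (hddpos : ∀ i, 0 < dd i) (hccpos : ∀ j, 0 < cc j) (hbbpos : ∀ k, 0 < bb k)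
    (hddmono : Monotone dd) (hccmono : Monotone cc) (hbbmono : Monotone bb)
    (R : JacRes f dd cc bb)
    -- the Hilbert polynomial of `M(f)` has degree exactly 1 (`Σ` is 1-dimensional):
    (hdim1 : ∃ a b : ℚ, a ≠ 0 ∧ ∃ N : ℕ, ∀ k : ℕ, N ≤ k → (hilb f k : ℚ) = a * k + b) :
    ∃ N : ℕ, ∀ u : ℕ, N ≤ u →
      (hilb f u : ℚ) =
        ((((d : ℚ) - 1) ^ 2 + (∑ i, (dd i : ℚ) ^ 2) - (∑ j, (cc j : ℚ) ^ 2)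
            + (∑ k, (bb k : ℚ) ^ 2)) / 2) * u -
        (((d : ℚ) * ((d : ℚ) - 3) ^ 2 - 4) / 3
          + (((d : ℚ) - 3) / 2) *
            ((∑ i, (dd i : ℚ) ^ 2) - (∑ j, (cc j : ℚ) ^ 2) + (∑ k, (bb k : ℚ) ^ 2))
          + (1 / 6) *
            ((∑ i, (dd i : ℚ) ^ 3) - (∑ j, (cc j : ℚ) ^ 3) + (∑ k, (bb k : ℚ) ^ 3))) := by
  obtain ⟨a0, b0, -, N0, hN0⟩ := hdim1
  have hd1 : 1 ≤ d := by omega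
  have hzero : ∀ n : ℕ, Module.finrank ℂ
      ((LinearMap.ker R.M3.mulVecLin).restrictScalars ℂ ⊓ gp (fun k => bb k + (d - 1)) n :
        Submodule ℂ _) = 0 := by
    intro n
    rw [LinearMap.ker_eq_bot.2 R.inj]
    have : ((⊥ : Submodule S4 (Fin r → S4)).restrictScalars ℂ ⊓ gp (fun k => bb k + (d - 1)) n :
        Submodule ℂ _) = ⊥ := by
      rw [Submodule.restrictScalars_bot, bot_inf_eq]
    rw [this, finrank_bot]
  set N1 := (d - 1) + ∑ i, dd i + ∑ j, cc j + ∑ k, bb k with hN1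
  have le1 : ∀ i, dd i ≤ ∑ i, dd i := fun i =>
    Finset.single_le_sum (f := dd) (fun _ _ => Nat.zero_le _) (Finset.mem_univ i)
  have le2 : ∀ i, cc i ≤ ∑ i, cc i := fun i =>
    Finset.single_le_sum (f := cc) (fun _ _ => Nat.zero_le _) (Finset.mem_univ i)
  have le3 : ∀ i, bb i ≤ ∑ i, bb i := fun i =>
    Finset.single_le_sum (f := bb) (fun _ _ => Nat.zero_le _) (Finset.mem_univ i)
  have main : ∀ n : ℕ, N1 ≤ n → (hilb f n : ℚ) =
      ((n : ℚ) + 3) * (n + 2) * (n + 1) / 6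
      - (4 * (((n : ℚ) + 3 - d) ^ 3 - (n + 3 - d))) / 6
      + (p * (((n : ℚ) + 3 - d) ^ 3 - (n + 3 - d)) - (3 * (n + 3 - d) ^ 2 - 1) * ∑ i, (dd i : ℚ)
        + 3 * (n + 3 - d) * ∑ i, (dd i : ℚ) ^ 2 - ∑ i, (dd i : ℚ) ^ 3) / 6
      - (q * (((n : ℚ) + 3 - d) ^ 3 - (n + 3 - d)) - (3 * (n + 3 - d) ^ 2 - 1) * ∑ i, (cc i : ℚ)
        + 3 * (n + 3 - d) * ∑ i, (cc i : ℚ) ^ 2 - ∑ i, (cc i : ℚ) ^ 3) / 6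
      + (r * (((n : ℚ) + 3 - d) ^ 3 - (n + 3 - d)) - (3 * (n + 3 - d) ^ 2 - 1) * ∑ i, (bb i : ℚ)
        + 3 * (n + 3 - d) * ∑ i, (bb i : ℚ) ^ 2 - ∑ i, (bb i : ℚ) ^ 3) / 6 := by
    intro n hn
    have e0 := hilb_eq f n
    have e1 := count (fun _ : Fin 4 => 0 + (d - 1)) (fun _ => 0) (M0 f) (by
      intro i j
      right
      refine ⟨by push_cast; omega, ?_⟩
      have : (pderiv j f).IsHomogeneous (d - 1) := hhom.pderiv
      simpa [M0] using this) n (fun j => by omega)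
    have e2 := count (fun i => dd i + (d - 1)) (fun _ : Fin 4 => 0 + (d - 1)) R.M1 (by
      intro i j
      right
      refine ⟨by push_cast; omega, ?_⟩
      have h := R.hM1 i j
      convert h using 1
      omega) n (fun j => by have := le1 j; omega)
    have e3 := count (fun i => cc i + (d - 1)) (fun i => dd i + (d - 1)) R.M2 (by
      intro i j
      have h := R.hM2 i j
      convert h using 1
      push_cast; ring) n (fun j => by have := le2 j; omega)
    have e4 := count (fun i => bb i + (d - 1)) (fun i => cc i + (d - 1)) R.M3 (by
      intro i j
      have h := R.hM3 i j
      convert h using 1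
      push_cast; ring) n (fun j => by have := le3 j; omega)
    rw [hzero, R.ex2] at e4
    rw [R.ex1] at e3
    rw [R.ex0, ← ker_M0] at e2
    have f0 := congrArg (Nat.cast : ℕ → ℚ) e0
    have f1 := congrArg (Nat.cast : ℕ → ℚ) e1
    have f2 := congrArg (Nat.cast : ℕ → ℚ) e2
    have f3 := congrArg (Nat.cast : ℕ → ℚ) e3
    have f4 := congrArg (Nat.cast : ℕ → ℚ) e4
    rw [choose3] at f0
    rw [sumchoose (fun _ : Fin 4 => 0) d n hd1 (fun j => by omega)] at f1
    rw [sumchoose dd d n hd1 (fun j => by have := le1 j; omega)] at f2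
    rw [sumchoose cc d n hd1 (fun j => by have := le2 j; omega)] at f3
    rw [sumchoose bb d n hd1 (fun j => by have := le3 j; omega)] at f4
    rw [Nat.cast_add] at f0 f1 f2 f3 f4
    simp only [Nat.cast_zero, Finset.sum_const_zero, Nat.cast_ofNat, ne_eq, OfNat.ofNat_ne_zero,
      not_false_eq_true, zero_pow, mul_zero, sub_zero, add_zero] at f1 f4
    linear_combination f0 - f1 + f2 - f3 + f4
  have hc : (p : ℚ) - q + r = 3 ∧ (d : ℚ) - 1 = (∑ i, (dd i : ℚ)) - (∑ i, (cc i : ℚ)) + ∑ i, (bb i : ℚ) := by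
    generalize (∑ i, (dd i : ℚ)) = D1 at *
    generalize (∑ i, (cc i : ℚ)) = C1 at *
    generalize (∑ i, (bb i : ℚ)) = B1 at *
    generalize (∑ i, (dd i : ℚ) ^ 2) = D2 at *
    generalize (∑ i, (cc i : ℚ) ^ 2) = C2 at *
    generalize (∑ i, (bb i : ℚ) ^ 2) = B2 at *
    generalize (∑ i, (dd i : ℚ) ^ 3) = D3 at *
    generalize (∑ i, (cc i : ℚ) ^ 3) = C3 at *
    generalize (∑ i, (bb i : ℚ) ^ 3) = B3 at *
    set P : ℚ := (p : ℚ) - q + r - 4 with hP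
    set E : ℚ := D1 - C1 + B1 with hE
    set G : ℚ := D2 - C2 + B2 with hG
    set K : ℚ := D3 - C3 + B3 with hK
    set s : ℚ := 3 - (d : ℚ) with hs
    obtain ⟨h1, h2⟩ := cubic_zero (1 + P) (6 + 3 * s * P - 3 * E)
      (11 + (3 * s ^ 2 - 1) * P - 6 * s * E + 3 * G - 6 * a0)
      (6 + (s ^ 3 - s) * P - (3 * s ^ 2 - 1) * E + 3 * s * G - K - 6 * b0)
      (N0 + N1) (by
        intro k hk
        have g1 := main k (by omega)
        have g2 := hN0 k (by omega)
        rw [g2] at g1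
        simp only [hP, hE, hG, hK, hs]
        linear_combination -6 * g1)
    refine ⟨by linear_combination h1, ?_⟩
    have hPv : P = -1 := by linear_combination h1
    rw [hPv] at h2
    linear_combination h2 / 3 + hs
  obtain ⟨hc1, hc2⟩ := hc
  refine ⟨N1, fun n hn => ?_⟩
  rw [main n hn]
  have hr : (r : ℚ) = 3 - p + q := by linear_combination hc1
  have hb : (∑ i, (bb i : ℚ)) = d - 1 - (∑ i, (dd i : ℚ)) + ∑ i, (cc i : ℚ) := by
    linear_combination -hc2
  rw [hr, hb]
  ring
end
end

section
/- (du Plessis–Wall) Let X : f = 0 be a reduced surface of degree d ≥ 3 in P³ with at most isolated singularities, and let d_1 = min{ k : AR(f)_k ≠ 0 } be the minimal degree of a nonzero Jacobian syzygy of f. Then (d−1)³ − d_1·(d−1)² ≤ τ(X) ≤ (d−1)³ − d_1·(d − d_1 − 1)·(d−1), where τ(X) is the total Tjurina number of X. -/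
open MvPolynomial

noncomputable section

/-- `ρ ∈ S⁴` is a Jacobian syzygy of `f`. -/
def isSyzygy (f : S4) (ρ : Fin 4 → S4) : Prop := ∑ i, ρ i * pderiv i f = 0

/-- `AR(f)ₖ ≠ 0`: there is a nonzero Jacobian syzygy of `f` all of whose components are
homogeneous of degree `k`. -/
def hasSyzygyOfDeg (f : S4) (k : ℕ) : Prop :=
  ∃ ρ : Fin 4 → S4, ρ ≠ 0 ∧ isSyzygy f ρ ∧ ∀ i, (ρ i).IsHomogeneous k

section CA
variable {R : Type*} [CommRing R]

def Rg (I : Ideal R) (g : R) : Prop := ∀ m, g * m ∈ I → m ∈ I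

lemma mem_sup_iff (I : Ideal R) (x m : R) : m ∈ I ⊔ Ideal.span {x} ↔ ∃ c, m - x * c ∈ I := by
  constructor
  · intro h
    obtain ⟨a, ha, b, hb, rfl⟩ := Submodule.mem_sup.1 h
    obtain ⟨c, rfl⟩ := Ideal.mem_span_singleton.1 hb
    exact ⟨c, by simpa using ha⟩
  · rintro ⟨c, hc⟩
    have : m = (m - x * c) + x * c := by ring
    rw [this]
    exact Submodule.add_mem_sup hc (Ideal.mem_span_singleton.2 ⟨c, rfl⟩)

lemma exch (I Q : Ideal R) {x y : R} (hx : Rg I x) (hy : Rg I y) (hxQ : x ∈ Q)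
    (h : ∀ m, (∀ q ∈ Q, q * m ∈ I ⊔ Ideal.span {x}) → m ∈ I ⊔ Ideal.span {x}) :
    ∀ m, (∀ q ∈ Q, q * m ∈ I ⊔ Ideal.span {y}) → m ∈ I ⊔ Ideal.span {y} := by
  intro m hm
  obtain ⟨n, hn⟩ := (mem_sup_iff _ _ _).1 (hm x hxQ)
  have h1 : n ∈ I ⊔ Ideal.span {x} := by
    apply h
    intro j hj
    obtain ⟨n', hn'⟩ := (mem_sup_iff _ _ _).1 (hm j hj)
    refine (mem_sup_iff _ _ _).2 ⟨n', hy _ ?_⟩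
    have : y * (j * n - x * n') = x * (j * m - y * n') - j * (x * m - y * n) := by ring
    rw [this]
    exact I.sub_mem (I.mul_mem_left _ hn') (I.mul_mem_left _ hn)
  obtain ⟨k, hk⟩ := (mem_sup_iff _ _ _).1 h1
  refine (mem_sup_iff _ _ _).2 ⟨k, hx _ ?_⟩
  have : x * (m - y * k) = (x * m - y * n) + y * (n - x * k) := by ring
  rw [this]
  exact I.add_mem hn (I.mul_mem_left _ hk)

lemma ass [IsNoetherianRing R] (I : Ideal R) : ∃ T : Set (Ideal R), T.Finite ∧
    (∀ Q ∈ T, Q.IsPrime ∧ ∃ m, m ∉ I ∧ ∀ q, q ∈ Q ↔ q * m ∈ I) ∧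
    ∀ g, (∀ Q ∈ T, g ∉ Q) → Rg I g := by
  refine ⟨associatedPrimes R (R ⧸ I), associatedPrimes.finite _ _, ?_, ?_⟩
  · intro Q hQ
    obtain ⟨hp, x, hx⟩ := isAssociatedPrime_iff.1 hQ
    obtain ⟨m, rfl⟩ := Ideal.Quotient.mk_surjective x
    have key : ∀ q, q ∈ Q ↔ q * m ∈ I := by
      intro q
      rw [hx, Submodule.mem_colon_singleton, Submodule.mem_bot, ← Ideal.Quotient.eq_zero_iff_mem,
        map_mul]
      rfl
    refine ⟨hp, m, ?_, key⟩
    intro hm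
    exact hp.ne_top ((Ideal.eq_top_iff_one _).2 ((key 1).2 (by simpa using hm)))
  · intro g hg m hm
    by_contra hmI
    obtain ⟨P, hP, hle⟩ := exists_le_isAssociatedPrime_of_isNoetherianRing R
      (Ideal.Quotient.mk I m) (by rwa [Ne, Ideal.Quotient.eq_zero_iff_mem])
    refine hg P hP (hle ?_)
    rw [Submodule.mem_colon_singleton, Submodule.mem_bot]
    change Ideal.Quotient.mk I (g * m) = 0
    rwa [Ideal.Quotient.eq_zero_iff_mem]

def Good (Q : Ideal R) : Prop := ∃ x1 ∈ Q, ∃ x2 ∈ Q, ∃ x3 ∈ Q, x1 ≠ 0 ∧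
  Rg (Ideal.span {x1}) x2 ∧ Rg (Ideal.span {x1} ⊔ Ideal.span {x2}) x3

variable [IsDomain R]

lemma rg_bot {x : R} (hx : x ≠ 0) : Rg (⊥ : Ideal R) x := by
  intro m hm
  simpa [hx] using hm

lemma G2 (Q : Ideal R) {x1 x2 g : R} (h1 : x1 ∈ Q) (h2 : x2 ∈ Q) (hx1 : x1 ≠ 0)
    (hx2 : Rg (Ideal.span {x1}) x2) (hg : g ≠ 0) :
    ∀ m, (∀ q ∈ Q, q * m ∈ Ideal.span {g}) → m ∈ Ideal.span {g} := by
  have := exch ⊥ Q (rg_bot hx1) (rg_bot hg) h1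
  simp only [bot_sup_eq] at this
  exact this fun m hm => hx2 _ (hm x2 h2)

lemma rg_swap {x y : R} (hx : x ≠ 0) (h : Rg (Ideal.span {x}) y) : Rg (Ideal.span {y}) x := by
  intro m hm
  obtain ⟨n, hn⟩ := Ideal.mem_span_singleton.1 hm
  obtain ⟨k, rfl⟩ := Ideal.mem_span_singleton.1
    (h n (by rw [← hn]; exact Ideal.mem_span_singleton.2 ⟨m, rfl⟩))
  refine Ideal.mem_span_singleton.2 ⟨k, mul_left_cancel₀ hx ?_⟩
  rw [hn]; ring

lemma G3 [IsNoetherianRing R] (Q : Ideal R) (hQ : Good Q) {g1 g2 : R} (hg1 : g1 ≠ 0)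
    (hg1Q : g1 ∈ Q)
    (hg2 : Rg (Ideal.span {g1}) g2) :
    ∀ m, (∀ q ∈ Q, q * m ∈ Ideal.span {g1} ⊔ Ideal.span {g2}) →
      m ∈ Ideal.span {g1} ⊔ Ideal.span {g2} := by
  obtain ⟨x1, h1, x2, h2, x3, h3, hx1, hx2, hx3⟩ := hQ
  -- choose y
  obtain ⟨T, hT, hTa, hTr⟩ := ass (Ideal.span {x1})
  obtain ⟨T', hT', hTa', hTr'⟩ := ass (Ideal.span {g1})
  have hy : ∃ y ∈ Q, ∀ P ∈ T ∪ T', y ∉ P := by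
    by_contra! hcon
    have hsub : (Q : Set R) ⊆ ⋃ P ∈ T ∪ T', (id P : Ideal R) := by
      intro y hy
      obtain ⟨P, hP, hyP⟩ := hcon y hy
      exact Set.mem_biUnion hP hyP
    obtain ⟨P, hP, hle⟩ := (Q.subset_union_prime_finite (hT.union hT') (f := id) 0 0
      (fun P hP _ _ => by
        rcases hP with hP | hP
        · exact (hTa P hP).1
        · exact (hTa' P hP).1)).1 hsub
    rcases hP with hP | hP
    · obtain ⟨_, m, hm, hq⟩ := hTa P hP
      exact hm (G2 Q h1 h2 hx1 hx2 hx1 m fun q hqQ => (hq q).1 (hle hqQ))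
    · obtain ⟨_, m, hm, hq⟩ := hTa' P hP
      exact hm (G2 Q h1 h2 hx1 hx2 hg1 m fun q hqQ => (hq q).1 (hle hqQ))
  obtain ⟨y, hyQ, hyP⟩ := hy
  have hyx : Rg (Ideal.span {x1}) y := hTr y fun P hP => hyP P (Or.inl hP)
  have hyg : Rg (Ideal.span {g1}) y := hTr' y fun P hP => hyP P (Or.inr hP)
  have e1 := exch _ Q hx2 hyx h2 fun m hm => hx3 _ (hm x3 h3)
  rw [sup_comm] at e1
  have e2 := exch _ Q (rg_swap hx1 hyx) (rg_swap hg1 hyg) h1 e1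
  rw [sup_comm] at e2
  exact exch _ Q hyg hg2 hyQ e2

lemma ass2 [IsNoetherianRing R] {g1 : R} (hg1 : g1 ≠ 0) : ∃ T : Set (Ideal R), T.Finite ∧
    (∀ Q ∈ T, Q.IsPrime ∧ g1 ∈ Q ∧ ¬ Good Q) ∧
    ∀ g, (∀ Q ∈ T, g ∉ Q) → Rg (Ideal.span {g1}) g := by
  obtain ⟨T, hT, hTa, hTr⟩ := ass (Ideal.span {g1})
  refine ⟨T, hT, fun Q hQ => ?_, hTr⟩
  obtain ⟨hp, m, hm, hq⟩ := hTa Q hQ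
  refine ⟨hp, (hq _).2 (Ideal.mul_mem_right _ _ (Ideal.mem_span_singleton_self _)), ?_⟩
  rintro ⟨x1, h1, x2, h2, x3, h3, hx1, hx2, hx3⟩
  exact hm (G2 Q h1 h2 hx1 hx2 hg1 m fun q hqQ => (hq q).1 hqQ)

lemma ass3 [IsNoetherianRing R] {g1 g2 : R} (hg1 : g1 ≠ 0) (hg2 : Rg (Ideal.span {g1}) g2) :
    ∃ T : Set (Ideal R), T.Finite ∧
    (∀ Q ∈ T, Q.IsPrime ∧ g1 ∈ Q ∧ g2 ∈ Q ∧ ¬ Good Q) ∧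
    ∀ g, (∀ Q ∈ T, g ∉ Q) → Rg (Ideal.span {g1} ⊔ Ideal.span {g2}) g := by
  obtain ⟨T, hT, hTa, hTr⟩ := ass (Ideal.span {g1} ⊔ Ideal.span {g2})
  refine ⟨T, hT, fun Q hQ => ?_, hTr⟩
  obtain ⟨hp, m, hm, hq⟩ := hTa Q hQ
  have hgQ : g1 ∈ Q := (hq _).2 (Ideal.mul_mem_right _ _
    (Ideal.mem_sup_left (Ideal.mem_span_singleton_self _)))
  refine ⟨hp, hgQ, (hq _).2 (Ideal.mul_mem_right _ _
    (Ideal.mem_sup_right (Ideal.mem_span_singleton_self _))), fun hG => ?_⟩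
  exact hm (G3 Q hG hg1 hgQ hg2 m fun q hqQ => (hq q).1 hqQ)

end CA
section Config

lemma bad1 (Q : Ideal S4) {p q : S4} (h : ¬ (p ∈ Q ∧ q ∈ Q)) :
    {t : ℂ | p + C t * q ∈ Q}.Finite := by
  apply Set.Subsingleton.finite
  intro t ht t' ht'
  by_contra hne
  apply h
  have hq : q ∈ Q := by
    have h1 : C (t - t') * q ∈ Q := by
      have := Q.sub_mem ht ht'
      have e : p + C t * q - (p + C t' * q) = C (t - t') * q := by
        rw [C_sub]; ring
      rwa [e] at this
    have h2 := Q.mul_mem_left (C (t - t')⁻¹) h1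
    rwa [← mul_assoc, ← C_mul, inv_mul_cancel₀ (sub_ne_zero.2 hne), C_1, one_mul] at h2
  refine ⟨?_, hq⟩
  have := Q.sub_mem ht (Q.mul_mem_left (C t) hq)
  simpa using this

lemma exists_avoid {s : Set ℂ} (h : s.Finite) : ∃ t, t ∉ s := h.infinite_compl.nonempty

structure St (J : Ideal S4) (D r : ℕ) (f0 f1 f2 f3 a0 a1 a2 a3 : S4) : Prop where
  h0 : f0.IsHomogeneous D
  h1 : f1.IsHomogeneous D
  h2 : f2.IsHomogeneous D
  h3 : f3.IsHomogeneous D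
  k0 : a0.IsHomogeneous r
  k1 : a1.IsHomogeneous r
  k2 : a2.IsHomogeneous r
  k3 : a3.IsHomogeneous r
  rel : a0 * f0 + a1 * f1 + a2 * f2 + a3 * f3 = 0
  hJ : J = Ideal.span {f0, f1, f2, f3}
  ne : f1 ≠ 0
  HJ : ∀ Q : Ideal S4, Q.IsPrime → f0 ∈ Q → f1 ∈ Q → f2 ∈ Q → f3 ∈ Q → Good Q
  HK : ∀ Q : Ideal S4, Q.IsPrime → a0 ∈ Q → a2 ∈ Q → a3 ∈ Q → f1 ∈ Q → Good Q

variable {J : Ideal S4} {D r : ℕ} {f0 f1 f2 f3 a0 a1 a2 a3 : S4}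

lemma St.swap03 (h : St J D r f0 f1 f2 f3 a0 a1 a2 a3) : St J D r f3 f1 f2 f0 a3 a1 a2 a0 where
  h0 := h.h3
  h1 := h.h1
  h2 := h.h2
  h3 := h.h0
  k0 := h.k3
  k1 := h.k1
  k2 := h.k2
  k3 := h.k0
  rel := by rw [← h.rel]; ring
  hJ := by rw [h.hJ]; congr 1; ext x; simp; tauto
  ne := h.ne
  HJ := fun Q p a b c d => h.HJ Q p d b c a
  HK := fun Q p a b c d => h.HK Q p c b a d

lemma St.swap02 (h : St J D r f0 f1 f2 f3 a0 a1 a2 a3) : St J D r f2 f1 f0 f3 a2 a1 a0 a3 where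
  h0 := h.h2
  h1 := h.h1
  h2 := h.h0
  h3 := h.h3
  k0 := h.k2
  k1 := h.k1
  k2 := h.k0
  k3 := h.k3
  rel := by rw [← h.rel]; ring
  hJ := by rw [h.hJ]; congr 1; ext x; simp; tauto
  ne := h.ne
  HJ := fun Q p a b c d => h.HJ Q p c b a d
  HK := fun Q p a b c d => h.HK Q p b a c d

lemma mem_of_shear (Q : Ideal S4) {p q : S4} (t : ℂ) (h : p + C t * q ∈ Q) (hq : q ∈ Q) : p ∈ Q := by
  have := Q.sub_mem h (Q.mul_mem_left (C t) hq)
  simpa using this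

lemma hom_shear {p q : S4} {n : ℕ} (t : ℂ) (hp : p.IsHomogeneous n) (hq : q.IsHomogeneous n) :
    (p + C t * q).IsHomogeneous n := hp.add (hq.C_mul t)

lemma St.shear (h : St J D r f0 f1 f2 f3 a0 a1 a2 a3) (t : ℂ) :
    St J D r f0 f1 (f2 + C t * f3) f3 a0 a1 a2 (a3 + C (-t) * a2) where
  h0 := h.h0
  h1 := h.h1
  h2 := hom_shear t h.h2 h.h3
  h3 := h.h3
  k0 := h.k0
  k1 := h.k1
  k2 := h.k2
  k3 := hom_shear _ h.k3 h.k2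
  rel := by rw [← h.rel, C_neg]; ring
  hJ := by
    rw [h.hJ]
    have m : ∀ (s : Set S4) x, x ∈ s → x ∈ Ideal.span s := fun s x hx => Ideal.subset_span hx
    apply le_antisymm <;> rw [Ideal.span_le] <;> rintro x (rfl | rfl | rfl | rfl)
    · exact m _ _ (by simp)
    · exact m _ _ (by simp)
    · exact mem_of_shear _ t (m _ _ (by simp)) (m {f0, f1, x + C t * f3, f3} f3 (by simp))
    · exact m _ _ (by simp)
    · exact m _ _ (by simp)
    · exact m _ _ (by simp)
    · exact Ideal.add_mem _ (m _ _ (by simp)) (Ideal.mul_mem_left _ _ (m _ _ (by simp)))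
    · exact m _ _ (by simp)
  ne := h.ne
  HJ := fun Q p a b c d => h.HJ Q p a b (mem_of_shear _ _ c d) d
  HK := fun Q p a b c d => h.HK Q p a b (mem_of_shear _ _ c b) d

lemma config (h : St J D r f0 f1 f2 f3 a0 a1 a2 a3) : ∃ f2 f3 a0 a2 a3, 
    St J D r f0 f1 f2 f3 a0 a1 a2 a3 ∧ Rg (Ideal.span {f1}) f2 ∧
    Rg (Ideal.span {f1} ⊔ Ideal.span {f2}) f3 ∧ Rg (Ideal.span {f1}) a0 ∧
    Rg (Ideal.span {f1} ⊔ Ideal.span {a0}) f2 ∧ Rg (Ideal.span {f1} ⊔ Ideal.span {a0}) a3 := by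
  obtain ⟨T, hT, hTa, hTr⟩ := ass2 h.ne
  -- step u
  obtain ⟨f2, a3, h, hu⟩ : ∃ f2 a3, St J D r f0 f1 f2 f3 a0 a1 a2 a3 ∧
      ∀ Q ∈ T, ¬ (f2 ∈ Q ∧ f0 ∈ Q) := by
    have : (⋃ Q ∈ T, {u : ℂ | f0 ∈ Q ∧ f2 + C u * f3 ∈ Q}).Finite := by
      refine hT.biUnion fun Q hQ => ?_
      obtain ⟨hp, h1, hG⟩ := hTa Q hQ
      by_cases h0 : f0 ∈ Q
      · exact (bad1 Q (p := f2) (q := f3) fun hh => hG (h.HJ Q hp h0 h1 hh.1 hh.2)).subset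
          fun u hu => hu.2
      · simp [h0]
    obtain ⟨u, hu⟩ := exists_avoid this
    refine ⟨_, _, h.shear u, fun Q hQ hh => hu ?_⟩
    exact Set.mem_biUnion hQ ⟨hh.2, hh.1⟩
  -- step s
  obtain ⟨f2, a0, h, hs, hs'⟩ : ∃ f2 a0, St J D r f0 f1 f2 f3 a0 a1 a2 a3 ∧
      (∀ Q ∈ T, f2 ∉ Q) ∧ (∀ Q ∈ T, ¬ (a0 ∈ Q ∧ a3 ∈ Q)) := by
    have b1 : (⋃ Q ∈ T, {u : ℂ | f2 + C u * f0 ∈ Q}).Finite :=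
      hT.biUnion fun Q hQ => bad1 Q (hu Q hQ)
    have b2 : (⋃ Q ∈ T, {u : ℂ | a3 ∈ Q ∧ a0 + C (-u) * a2 ∈ Q}).Finite := by
      refine hT.biUnion fun Q hQ => ?_
      obtain ⟨hp, h1, hG⟩ := hTa Q hQ
      by_cases h0 : a3 ∈ Q
      · have := (bad1 Q (p := a0) (q := a2)
          fun hh => hG (h.HK Q hp hh.1 hh.2 h0 h1)).preimage (f := fun u : ℂ => -u)
          (neg_injective.injOn)
        exact this.subset fun u hu => hu.2
      · simp [h0]
    obtain ⟨u, hu⟩ := exists_avoid (b1.union b2)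
    refine ⟨_, _, (h.swap03.shear u).swap03, fun Q hQ hh => hu (Or.inl ?_),
      fun Q hQ hh => hu (Or.inr ?_)⟩
    · exact Set.mem_biUnion hQ hh
    · exact Set.mem_biUnion hQ ⟨hh.2, hh.1⟩
  have r2 := hTr f2 hs
  obtain ⟨T2, hT2, hTa2, hTr2⟩ := ass3 h.ne r2
  -- step s'
  obtain ⟨f3, a0, h, hs3, hs'⟩ : ∃ f3 a0, St J D r f0 f1 f2 f3 a0 a1 a2 a3 ∧
      (∀ Q ∈ T2, f3 ∉ Q) ∧ (∀ Q ∈ T, a0 ∉ Q) := by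
    have b1 : (⋃ Q ∈ T2, {u : ℂ | f3 + C u * f0 ∈ Q}).Finite := by
      refine hT2.biUnion fun Q hQ => bad1 Q ?_
      obtain ⟨hp, h1, h2, hG⟩ := hTa2 Q hQ
      exact fun hh => hG (h.HJ Q hp hh.2 h1 h2 hh.1)
    have b2 : (⋃ Q ∈ T, {u : ℂ | a0 + C (-u) * a3 ∈ Q}).Finite := by
      refine hT.biUnion fun Q hQ => ?_
      have := (bad1 Q (hs' Q hQ)).preimage (f := fun u : ℂ => -u) (neg_injective.injOn)
      exact this
    obtain ⟨u, hu⟩ := exists_avoid (b1.union b2)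
    have h' := ((h.swap02.swap03.swap02).swap03.shear u).swap03.swap02.swap03.swap02
    refine ⟨_, _, h', fun Q hQ hh => hu (Or.inl ?_),
      fun Q hQ hh => hu (Or.inr ?_)⟩
    · exact Set.mem_biUnion hQ hh
    · exact Set.mem_biUnion hQ hh
  have r3 := hTr2 f3 hs3
  have ra0 := hTr a0 hs'
  have good : ∀ Q : Ideal S4, f1 ∈ Q → f2 ∈ Q → f3 ∈ Q → Good Q := fun Q q1 q2 q3 =>
    ⟨f1, q1, f2, q2, f3, q3, h.ne, r2, r3⟩
  obtain ⟨T3, hT3, hTa3, hTr3⟩ := ass3 h.ne ra0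
  have b1 : (⋃ Q ∈ T, {u : ℂ | f2 + C u * f3 ∈ Q}).Finite :=
    hT.biUnion fun Q hQ => bad1 Q fun hh => hs Q hQ hh.1
  have b2 : (⋃ Q ∈ T3, {u : ℂ | f2 + C u * f3 ∈ Q}).Finite :=
    hT3.biUnion fun Q hQ => bad1 Q fun hh => (hTa3 Q hQ).2.2.2 (good Q (hTa3 Q hQ).2.1 hh.1 hh.2)
  have b3 : (⋃ Q ∈ T3, {u : ℂ | a3 + C (-u) * a2 ∈ Q}).Finite := by
    refine hT3.biUnion fun Q hQ => ?_
    obtain ⟨hp, h1, h2, hG⟩ := hTa3 Q hQ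
    have := (bad1 Q (p := a3) (q := a2) fun hh => hG (h.HK Q hp h2 hh.2 hh.1 h1)).preimage
      (f := fun u : ℂ => -u) (neg_injective.injOn)
    exact this
  obtain ⟨t, ht⟩ := exists_avoid (b1.union (b2.union b3))
  have r2' : Rg (Ideal.span {f1}) (f2 + C t * f3) :=
    hTr _ fun Q hQ hh => ht (Or.inl (Set.mem_biUnion hQ hh))
  refine ⟨_, _, _, _, _, h.shear t, r2', ?_, ra0,
    hTr3 _ fun Q hQ hh => ht (Or.inr (Or.inl (Set.mem_biUnion hQ hh))),
    hTr3 _ fun Q hQ hh => ht (Or.inr (Or.inr (Set.mem_biUnion hQ hh)))⟩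
  obtain ⟨T4, hT4, hTa4, hTr4⟩ := ass3 h.ne r2'
  apply hTr4
  intro Q hQ h3
  obtain ⟨hp, h1, h2, hG⟩ := hTa4 Q hQ
  exact hG (good Q h1 (mem_of_shear _ _ h2 h3) h3)

end Config

section HFsec

abbrev Sk (k : ℕ) : Submodule ℂ S4 := homogeneousSubmodule (Fin 4) ℂ k

instance (k : ℕ) : FiniteDimensional ℂ (Sk k) :=
  Module.Finite.iff_fg.2 (homogeneousSubmodule_fg (Fin 4) ℂ k)

abbrev Pk (I : Ideal S4) (k : ℕ) : Submodule ℂ S4 := Sk k ⊓ I.restrictScalars ℂ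

instance (I : Ideal S4) (k : ℕ) : FiniteDimensional ℂ (Pk I k) :=
  Submodule.finiteDimensional_of_le inf_le_left

def HF (I : Ideal S4) (k : ℕ) : ℤ :=
  (Module.finrank ℂ (Sk k) : ℤ) - Module.finrank ℂ (Pk I k)

lemma HF_nonneg (I : Ideal S4) (k : ℕ) : 0 ≤ HF I k := by
  have : Module.finrank ℂ (Pk I k) ≤ Module.finrank ℂ (Sk k) :=
    Submodule.finrank_mono inf_le_left
  unfold HF; omega

lemma HF_anti {I J : Ideal S4} (h : I ≤ J) (k : ℕ) : HF J k ≤ HF I k := by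
  have : Module.finrank ℂ (Pk I k) ≤ Module.finrank ℂ (Pk J k) :=
    Submodule.finrank_mono (inf_le_inf_left _ h)
  unfold HF; omega

lemma hilb_eq_s6 (f : S4) (k : ℕ) : (hilb f k : ℤ) = HF (jacIdeal f) k := by
  have h1 := Submodule.finrank_quotient_add_finrank (Submodule.comap (Sk k).subtype
        (Submodule.restrictScalars ℂ (jacIdeal f)))
  have h2 : Module.finrank ℂ (Submodule.comap (Sk k).subtype
        (Submodule.restrictScalars ℂ (jacIdeal f))) = Module.finrank ℂ (Pk (jacIdeal f) k) := by
    rw [← Submodule.finrank_map_subtype_eq, Submodule.map_comap_subtype]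
  unfold HF hilb
  change _ = ((Module.finrank ℂ (Sk k) : ℕ) : ℤ) - _
  rw [← h2, ← h1]
  push_cast
  ring

def HI (I : Ideal S4) : Prop := ∀ m ∈ I, ∀ k, homogeneousComponent k m ∈ I

lemma hc_mul {g : S4} {e : ℕ} (hg : g.IsHomogeneous e) (w : S4) (k : ℕ) :
    homogeneousComponent (k + e) (g * w) = g * homogeneousComponent k w := by
  conv_lhs => rw [← sum_homogeneousComponent w, Finset.mul_sum, map_sum]
  have : ∀ i, homogeneousComponent (k + e) (g * homogeneousComponent i w) =
      if i = k then g * homogeneousComponent k w else 0 := by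
    intro i
    have := hg.mul (homogeneousComponent_isHomogeneous i w)
    rw [homogeneousComponent_of_mem this]
    by_cases h : i = k
    · subst h; simp [add_comm]
    · rw [if_neg (by omega), if_neg h]
  simp_rw [this]
  rw [Finset.sum_ite_eq']
  split_ifs with h
  · rfl
  · rw [homogeneousComponent_eq_zero, mul_zero]
    simpa using h

lemma HI_span {g : S4} {e : ℕ} (hg : g.IsHomogeneous e) : HI (Ideal.span {g}) := by
  intro m hm k
  obtain ⟨w, rfl⟩ := Ideal.mem_span_singleton.1 hm
  by_cases h : e ≤ k
  · obtain ⟨j, rfl⟩ := Nat.exists_eq_add_of_le' h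
    rw [hc_mul hg]
    exact Ideal.mem_span_singleton.2 ⟨_, rfl⟩
  · rw [← sum_homogeneousComponent w, Finset.mul_sum, map_sum]
    apply Ideal.sum_mem
    intro i _
    rw [homogeneousComponent_of_mem (hg.mul (homogeneousComponent_isHomogeneous i w)),
      if_neg (by omega)]
    exact Ideal.zero_mem _

lemma HI_sup {I J : Ideal S4} (hI : HI I) (hJ : HI J) : HI (I ⊔ J) := by
  intro m hm k
  obtain ⟨a, ha, b, hb, rfl⟩ := Submodule.mem_sup.1 hm
  rw [map_add]
  exact Submodule.add_mem_sup (hI a ha k) (hJ b hb k)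

lemma HI_bot : HI (⊥ : Ideal S4) := by
  intro m hm k
  rw [Ideal.mem_bot] at hm ⊢
  rw [hm, map_zero]

def cln (I : Ideal S4) (g : S4) : Ideal S4 where
  carrier := {m | g * m ∈ I}
  add_mem' := by
    intro a b ha hb
    simp only [Set.mem_ofPred_eq, mul_add] at *
    exact I.add_mem ha hb
  zero_mem' := by simp
  smul_mem' := by
    intro c x hx
    simp only [Set.mem_ofPred_eq, smul_eq_mul] at *
    rw [mul_left_comm]
    exact I.mul_mem_left _ hx

lemma mem_cln {I : Ideal S4} {g m : S4} : m ∈ cln I g ↔ g * m ∈ I := Iff.rfl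

lemma cln_rg {I : Ideal S4} {g : S4} (h : Rg I g) : cln I g = I :=
  le_antisymm (fun m hm => h m hm) (fun _ hm => I.mul_mem_left _ hm)

lemma HF_colon {I : Ideal S4} (hI : HI I) {g : S4} {e : ℕ} (hg : g.IsHomogeneous e) (k : ℕ) :
    HF (I ⊔ Ideal.span {g}) (k + e) = HF I (k + e) - HF (cln I g) k := by
  by_cases h0 : g = 0
  · subst h0
    have h1 : I ⊔ Ideal.span {0} = I := by simp
    have h2 : cln I 0 = ⊤ := by
      rw [eq_top_iff]; intro x _; rw [mem_cln]; simp
    have h3 : Pk ⊤ k = Sk k := by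
      ext x; simp
    rw [h1, h2]
    have : HF ⊤ k = 0 := by unfold HF; rw [h3]; simp
    omega
  set L : S4 →ₗ[ℂ] S4 := LinearMap.mulLeft ℂ g with hL
  have hinj : Function.Injective L := by
    intro a b hab
    exact mul_left_cancel₀ h0 hab
  have e1 : Pk (I ⊔ Ideal.span {g}) (k + e) = Pk I (k + e) ⊔ (Sk k).map L := by
    apply le_antisymm
    · rintro x ⟨hx, hx2⟩
      obtain ⟨a, ha, b, hb, hab⟩ := Submodule.mem_sup.1 hx2
      obtain ⟨w, rfl⟩ := Ideal.mem_span_singleton.1 hb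
      have hx3 : homogeneousComponent (k + e) x = x := by
        rw [homogeneousComponent_of_mem hx, if_pos rfl]
      rw [← hx3, ← hab, map_add, hc_mul hg]
      refine Submodule.add_mem_sup ⟨homogeneousComponent_isHomogeneous _ _, hI a ha _⟩
        ⟨_, homogeneousComponent_isHomogeneous k w, rfl⟩
    · refine sup_le (inf_le_inf_left _ (fun x hx => ?_)) ?_
      · exact (le_sup_left : I ≤ I ⊔ _) hx
      · rintro _ ⟨w, hw, rfl⟩
        refine ⟨?_, ?_⟩
        · have := hg.mul hw
          rw [add_comm] at this
          exact this
        · exact (le_sup_right : _ ≤ I ⊔ Ideal.span {g}) (Ideal.mem_span_singleton.2 ⟨_, rfl⟩)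
  have e2 : Pk I (k + e) ⊓ (Sk k).map L = (Pk (cln I g) k).map L := by
    ext x
    constructor
    · rintro ⟨⟨_, hx⟩, w, hw, rfl⟩
      exact ⟨w, ⟨hw, hx⟩, rfl⟩
    · rintro ⟨w, ⟨hw, hw2⟩, rfl⟩
      refine ⟨⟨?_, hw2⟩, w, hw, rfl⟩
      have := hg.mul hw
      rw [add_comm] at this
      exact this
  have h3 := Submodule.finrank_sup_add_finrank_inf_eq (Pk I (k + e)) ((Sk k).map L)
  rw [← e1, e2, ← (Submodule.equivMapOfInjective L hinj _).finrank_eq,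
    ← (Submodule.equivMapOfInjective L hinj _).finrank_eq] at h3
  unfold HF
  omega

lemma HF_reg {I : Ideal S4} (hI : HI I) {g : S4} {e : ℕ} (hg : g.IsHomogeneous e) (h : Rg I g)
    (k : ℕ) : HF (I ⊔ Ideal.span {g}) (k + e) = HF I (k + e) - HF I k := by
  rw [HF_colon hI hg, cln_rg h]

lemma finrank_Sk (k : ℕ) : (6 * (Module.finrank ℂ (Sk k) : ℤ)) = (k + 1) * (k + 2) * (k + 3) := by
  have h : (Finset.univ.finsuppAntidiag k : Finset (Fin 4 →₀ ℕ)) = {d : Fin 4 →₀ ℕ | d.degree = k} := by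
    ext d; simp [Finsupp.degree_eq_sum]
  have h2 : Module.finrank ℂ (Sk k) = (k + 3).choose 3 := by
    have e : Sk k = _ := homogeneousSubmodule_eq_finsupp_supported (Fin 4) ℂ k
    rw [e, ← h, (AddMonoidAlgebra.supportedEquivFinsupp _).finrank_eq]
    simp [Finset.card_finsuppAntidiag_nat_eq_choose]
    rw [add_comm 3 k]
    exact Nat.choose_symm_of_eq_add rfl
  rw [h2]
  have h3 := Nat.add_one_mul_choose_eq (k + 2) 2
  have h4 := Nat.add_one_mul_choose_eq (k + 1) 1
  simp only [Nat.choose_one_right] at h4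
  norm_num at h3 h4
  zify at h3 h4
  push_cast at *
  linear_combination (-2) * h3 - (k + 3) * h4

lemma HF_bot (k : ℕ) : 6 * HF ⊥ k = (k + 1) * (k + 2) * (k + 3) := by
  have : Pk ⊥ k = ⊥ := by
    rw [eq_bot_iff]; rintro x ⟨_, hx⟩; simpa using hx
  unfold HF
  rw [this, ← finrank_Sk]
  simp

lemma HF_ci {g1 g2 g3 : S4} {e1 e2 e3 : ℕ} (h1 : g1.IsHomogeneous e1) (h2 : g2.IsHomogeneous e2)
    (h3 : g3.IsHomogeneous e3) (hg1 : g1 ≠ 0) (hg2 : Rg (Ideal.span {g1}) g2)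
    (hg3 : Rg (Ideal.span {g1} ⊔ Ideal.span {g2}) g3) (k : ℕ) (hk : e1 + e2 + e3 ≤ k) :
    HF (Ideal.span {g1} ⊔ Ideal.span {g2} ⊔ Ideal.span {g3}) k = e1 * e2 * e3 := by
  obtain ⟨k, rfl⟩ := Nat.exists_eq_add_of_le' hk
  have A : ∀ k, 6 * HF (Ideal.span {g1}) (k + e1) = (k + e1 + 1) * (k + e1 + 2) * (k + e1 + 3) -
      (k + 1) * (k + 2) * (k + 3) := by
    intro k
    have := HF_reg HI_bot h1 (rg_bot hg1) k
    rw [bot_sup_eq] at this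
    rw [this, mul_sub, HF_bot, HF_bot]
    push_cast; ring
  have B := HF_reg (HI_span h1) h2 hg2
  have C := HF_reg (HI_sup (HI_span h1) (HI_span h2)) h3 hg3 (k + e1 + e2)
  rw [← add_assoc, ← add_assoc, C, B, show k + e1 + e2 + e3 = (k + e1 + e3) + e2 by ring, B]
  have q1 := A k
  have q2 := A (k + e2)
  have q3 := A (k + e3)
  have q4 := A (k + e3 + e2)
  rw [show k + e2 + e1 = k + e1 + e2 by ring] at q2
  rw [show k + e3 + e1 = k + e1 + e3 by ring] at q3
  rw [show k + e3 + e2 + e1 = k + e1 + e3 + e2 by ring] at q4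
  push_cast at *
  have : 6 * (HF (Ideal.span {g1}) (k + e1 + e3 + e2) - HF (Ideal.span {g1}) (k + e1 + e3) -
    (HF (Ideal.span {g1}) (k + e1 + e2) - HF (Ideal.span {g1}) (k + e1))) = 6 * (e1 * e2 * e3) := by
    rw [mul_sub, mul_sub, mul_sub, q1, q2, q3, q4]; ring
  linarith

end HFsec

section bounds
variable {J : Ideal S4} {D r : ℕ} {f0 f1 f2 f3 a0 a1 a2 a3 : S4}

lemma bounds (h : St J D r f0 f1 f2 f3 a0 a1 a2 a3) (K : ℕ) (hK : 4 * D + r ≤ K) :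
    (D : ℤ) ^ 3 - r * D ^ 2 ≤ HF J K ∧ HF J K ≤ (D : ℤ) ^ 3 - r * D ^ 2 + r ^ 2 * D := by
  obtain ⟨f2, f3, a0, a2, a3, h, c1, c2, c3, c4, c5⟩ := config h
  set I := Ideal.span {f1} ⊔ Ideal.span {f2} ⊔ Ideal.span {f3} with hI
  set A := Ideal.span {f1} ⊔ Ideal.span {a0} ⊔ Ideal.span {f2} with hA
  have hIm : ∀ x, x ∈ I ↔ ∃ u v w, x = f1 * u + f2 * v + f3 * w := by
    intro x
    rw [hI, mem_sup_iff]
    constructor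
    · rintro ⟨w, hw⟩
      obtain ⟨v, hv⟩ := (mem_sup_iff _ _ _).1 hw
      obtain ⟨u, hu⟩ := Ideal.mem_span_singleton.1 hv
      exact ⟨u, v, w, by linear_combination hu⟩
    · rintro ⟨u, v, w, rfl⟩
      exact ⟨w, (mem_sup_iff _ _ _).2 ⟨v, Ideal.mem_span_singleton.2 ⟨u, by ring⟩⟩⟩
  have hJ : J = I ⊔ Ideal.span {f0} := by
    rw [h.hJ, hI]
    simp only [Ideal.span_insert]
    ac_rfl
  have hIH : HI I := HI_sup (HI_sup (HI_span h.h1) (HI_span h.h2)) (HI_span h.h3)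
  have hAH : HI A := HI_sup (HI_sup (HI_span h.h1) (HI_span h.k0)) (HI_span h.h2)
  obtain ⟨k, rfl⟩ := Nat.exists_eq_add_of_le' (show D ≤ K by omega)
  have e1 := HF_colon hIH h.h0 k
  rw [← hJ, HF_ci h.h1 h.h2 h.h3 h.ne c1 c2 _ (by omega)] at e1
  have hA1 : A ≤ cln I f0 := by
    refine sup_le (sup_le ?_ ?_) ?_ <;>
      rw [Ideal.span_singleton_le_iff_mem, mem_cln, hIm]
    · exact ⟨f0, 0, 0, by ring⟩
    · exact ⟨-a1, -a2, -a3, by linear_combination h.rel⟩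
    · exact ⟨0, f0, 0, by ring⟩
  have hA2 : cln I f0 ≤ cln A a3 := by
    intro e0 he
    rw [mem_cln, hIm] at he
    obtain ⟨e1, e2, e3, he⟩ := he
    have : f3 * (a0 * e3 + e0 * a3) ∈ Ideal.span {f1} ⊔ Ideal.span {f2} := by
      refine (mem_sup_iff _ _ _).2 ⟨-(a0 * e2 + a2 * e0), Ideal.mem_span_singleton.2
        ⟨-(a0 * e1 + a1 * e0), ?_⟩⟩
      linear_combination (-a0) * he + e0 * h.rel
    obtain ⟨v, hv⟩ := (mem_sup_iff _ _ _).1 (c2 _ this)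
    obtain ⟨u, hu⟩ := Ideal.mem_span_singleton.1 hv
    rw [mem_cln, hA]
    refine (mem_sup_iff _ _ _).2 ⟨v, (mem_sup_iff _ _ _).2 ⟨-e3, Ideal.mem_span_singleton.2
      ⟨u, ?_⟩⟩⟩
    linear_combination hu
  have b1 := HF_anti hA1 k
  have b2 := HF_anti hA2 k
  have e2 := HF_colon hAH h.k3 k
  rw [HF_ci h.h1 h.k0 h.h2 h.ne c3 c4 _ (by omega)] at e2 b1
  have b3 : HF (A ⊔ Ideal.span {a3}) (k + r) ≤ _ := HF_anti
    (sup_le_sup_right (le_sup_left : Ideal.span {f1} ⊔ Ideal.span {a0} ≤ A) (Ideal.span {a3})) (k + r)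
  rw [HF_ci h.h1 h.k0 h.k3 h.ne c3 c5 _ (by omega)] at b3
  constructor <;> nlinarith
end bounds

section P4

lemma eval_hom {p : S4} {n : ℕ} (hp : p.IsHomogeneous n) (c : ℂ) (q : Fin 4 → ℂ) :
    eval (c • q) p = c ^ n * eval q p := by
  rw [eval_eq, eval_eq, Finset.mul_sum]
  apply Finset.sum_congr rfl
  intro d hd
  have h : d.degree = n := by
    have := hp (mem_support_iff.1 hd)
    rw [Finsupp.degree_eq_weight_one]
    exact this
  rw [← h, Finsupp.degree_eq_sum, ← Finset.prod_pow_eq_pow_sum]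
  simp only [Pi.smul_apply, smul_eq_mul, mul_pow, Finset.prod_mul_distrib]
  have h1 : ∀ g : Fin 4 → ℂ, ∏ i ∈ d.support, g i ^ d i = ∏ i, g i ^ d i := by
    intro g
    exact Finset.prod_subset (Finset.subset_univ _) (by intro x _ hx; simp at hx; simp [hx])
  rw [h1 (fun _ => c), h1 q]
  ring

lemma avoid {ι : Type*} (s : Finset ι) (P : ι → S4) (h : ∀ i ∈ s, P i ≠ 0) :
    ∃ v : Fin 4 → ℂ, ∀ i ∈ s, eval v (P i) ≠ 0 := by
  have h1 : (∏ i ∈ s, P i) ≠ 0 := Finset.prod_ne_zero_iff.2 h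
  by_contra hc
  push Not at hc
  apply h1
  apply MvPolynomial.funext
  intro v
  obtain ⟨i, hi, h0⟩ := hc v
  rw [map_prod, map_zero]
  exact Finset.prod_eq_zero hi h0

lemma nulls (K Q : Ideal S4) (hQ : Q.IsPrime) (hK : K ≤ Q) {F : S4}
    (h : ∀ q, (∀ p ∈ K, eval q p = 0) → eval q F = 0) : F ∈ Q := by
  have : F ∈ K.radical := by
    rw [← vanishingIdeal_zeroLocus_eq_radical (K := ℂ), mem_vanishingIdeal_iff]
    intro x hx
    rw [mem_zeroLocus_iff] at hx
    exact h x hx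
  exact (hQ.radical_le_iff.2 hK) this

lemma lemN (K Q : Ideal S4) (hQ : Q.IsPrime) (hK : K ≤ Q) {g : S4} (hg : g ∉ Q)
    (L : Finset (Fin 4 → ℂ))
    (h : ∀ q, (∀ p ∈ K, eval q p = 0) → eval q g = 0 ∨ ∃ p ∈ L, ∃ c : ℂ, q = c • p) :
    ∃ p ∈ L, ∀ i j, C (p j) * X i - C (p i) * X j ∈ Q := by
  by_contra hc
  push Not at hc
  have hc' : ∀ p : L, ∃ ij : Fin 4 × Fin 4, C (p.1 ij.2) * X ij.1 - C (p.1 ij.1) * X ij.2 ∉ Q := by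
    rintro ⟨p, hp⟩
    obtain ⟨i, j, h⟩ := hc p hp
    exact ⟨(i, j), h⟩
  choose t ht using hc'
  have := nulls K Q hQ hK (F := g * ∏ p : L,
    (C (p.1 (t p).2) * X (t p).1 - C (p.1 (t p).1) * X (t p).2)) (by
      intro q hq
      rw [map_mul, map_prod]
      rcases h q hq with h | ⟨p, hp, c, rfl⟩
      · rw [h, zero_mul]
      · rw [Finset.prod_eq_zero (Finset.mem_univ (⟨p, hp⟩ : L)), mul_zero]
        simp; ring)
  rcases hQ.mem_or_mem this with h | h
  · exact hg h
  · obtain ⟨p, _, hp⟩ := (hQ.prod_mem_iff).1 h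
    exact ht p hp

lemma rg_theta (θ : S4 →ₐ[ℂ] S4) (I : Ideal S4) (h1 : ∀ i, X i - θ (X i) ∈ I)
    (h2 : ∀ x ∈ I, θ x = 0) {g : S4} (hg : θ g ≠ 0) : Rg I g := by
  have h3 : ∀ m, m - θ m ∈ I := by
    intro m
    have : (Ideal.Quotient.mkₐ ℂ I) = (Ideal.Quotient.mkₐ ℂ I).comp θ := by
      apply MvPolynomial.algHom_ext
      intro i
      have := h1 i
      rw [← Ideal.Quotient.eq] at this
      exact this
    have := DFunLike.congr_fun this m
    rw [← Ideal.Quotient.eq]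
    exact this
  intro m hm
  have h4 := h2 _ hm
  rw [map_mul] at h4
  have h5 := (mul_eq_zero.1 h4).resolve_left hg
  have := h3 m
  rwa [h5, sub_zero] at this

lemma good_lin (Q : Ideal S4) (p : Fin 4 → ℂ) (hp : p ≠ 0)
    (h : ∀ i j, C (p j) * X i - C (p i) * X j ∈ Q) : Good Q := by
  obtain ⟨j, hj⟩ := Function.ne_iff.1 hp
  have hj : p j ≠ 0 := hj
  set t : Fin 4 → ℂ := fun i => p i / p j with ht
  have hx : ∀ i, (X i - C (t i) * X j : S4) ∈ Q := by
    intro i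
    have := Q.mul_mem_left (C (p j)⁻¹) (h i j)
    convert this using 1
    rw [mul_sub, ← mul_assoc, ← mul_assoc, ← C_mul, ← C_mul, inv_mul_cancel₀ hj, ht]
    simp [div_eq_inv_mul]
  have hne : ∀ i, i ≠ j → (X i - C (t i) * X j : S4) ≠ 0 := by
    intro i hi h0
    have := congrArg (eval (Pi.single i (1 : ℂ))) h0
    simp [hi.symm] at this
  obtain ⟨i1, i2, i3, n1, n2, n3, n12, n13, n23⟩ : ∃ i1 i2 i3 : Fin 4, i1 ≠ j ∧ i2 ≠ j ∧ i3 ≠ j ∧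
      i1 ≠ i2 ∧ i1 ≠ i3 ∧ i2 ≠ i3 := by
    clear * - ; revert j; decide
  refine ⟨_, hx i1, _, hx i2, _, hx i3, hne _ n1, ?_, ?_⟩
  · apply rg_theta (aeval (fun i => if i = i1 then C (t i1) * X j else X i))
    · intro i
      rw [aeval_X]
      split_ifs with hi
      · subst hi; exact Ideal.mem_span_singleton_self _
      · simp
    · intro x hx
      obtain ⟨w, rfl⟩ := Ideal.mem_span_singleton.1 hx
      rw [map_mul]
      simp [n1.symm, ← MvPolynomial.algebraMap_eq]
    · have := hne i2 n2
      simpa [n1.symm, n12.symm, ← MvPolynomial.algebraMap_eq] using this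
  · apply rg_theta (aeval (fun i => if i = i1 then C (t i1) * X j else if i = i2 then
      C (t i2) * X j else X i))
    · intro i
      rw [aeval_X]
      split_ifs with hi hi2
      · subst hi; exact Ideal.mem_sup_left (Ideal.mem_span_singleton_self _)
      · subst hi2; exact Ideal.mem_sup_right (Ideal.mem_span_singleton_self _)
      · simp
    · intro x hx
      obtain ⟨c, hc⟩ := (mem_sup_iff _ _ _).1 hx
      obtain ⟨w, hw⟩ := Ideal.mem_span_singleton.1 hc
      rw [sub_eq_iff_eq_add.1 hw, map_add, map_mul, map_mul]
      simp [n1.symm, n2.symm, n12.symm, ← MvPolynomial.algebraMap_eq]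
    · have := hne i3 n3
      simpa [n1.symm, n2.symm, n13.symm, n23.symm, ← MvPolynomial.algebraMap_eq] using this

lemma singL {f : S4} {D : ℕ} (hh : ∀ i, (pderiv i f).IsHomogeneous D)
    (hiso : (singLocus f).Finite) : ∃ L : Finset (Fin 4 → ℂ), L.Nonempty ∧ (∀ p ∈ L, p ≠ 0) ∧
    ∀ q : Fin 4 → ℂ, (∀ i, eval q (pderiv i f) = 0) → ∃ p ∈ L, ∃ c : ℂ, q = c • p := by
  classical
  refine ⟨insert (fun _ => 1) (hiso.toFinset.image (fun P => P.rep)), Finset.insert_nonempty _ _,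
    ?_, ?_⟩
  · intro p hp
    rcases Finset.mem_insert.1 hp with rfl | hp
    · intro h; simpa using congrFun h 0
    · obtain ⟨P, _, rfl⟩ := Finset.mem_image.1 hp
      exact P.rep_nonzero
  · intro q hq
    by_cases h0 : q = 0
    · exact ⟨_, Finset.mem_insert_self _ _, 0, by simp [h0]⟩
    obtain ⟨a, ha⟩ := Projectivization.exists_smul_eq_mk_rep ℂ q h0
    have ha' : (a : ℂ) • q = (Projectivization.mk ℂ q h0).rep := ha
    refine ⟨_, Finset.mem_insert_of_mem (Finset.mem_image.2
      ⟨Projectivization.mk ℂ q h0, ?_, rfl⟩), (a : ℂ)⁻¹, ?_⟩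
    · rw [Set.Finite.mem_toFinset]
      intro i
      rw [← ha', eval_hom (hh i), hq i, mul_zero]
    · rw [← ha', smul_smul, inv_mul_cancel₀ a.ne_zero, one_smul]

lemma HI_iSup {ι : Type*} [Fintype ι] (g : ι → S4) {D : ℕ} (hh : ∀ i, (g i).IsHomogeneous D) :
    HI (Ideal.span (Set.range g)) := by
  intro m hm k
  obtain ⟨c, rfl⟩ := (Ideal.mem_span_range_iff_exists_fun).1 hm
  rw [map_sum]
  apply Ideal.sum_mem
  intro i _
  have := HI_span (hh i) (c i * g i) (Ideal.mem_span_singleton.2 ⟨c i, by ring⟩) k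
  exact Ideal.span_mono (by simp) this

lemma event_const {f : S4} {D : ℕ} (hh : ∀ i, (pderiv i f).IsHomogeneous D)
    (hiso : (singLocus f).Finite) : ∃ N τ : ℕ, ∀ k, N ≤ k → hilb f k = τ := by
  obtain ⟨L, -, hL0, hL⟩ := singL hh hiso
  obtain ⟨v, hv⟩ := avoid L (fun p => ∑ i, C (p i) * X i) (by
    intro p hp h0
    apply hL0 p hp
    ext j
    have := congrArg (eval (Pi.single j (1 : ℂ))) h0
    simpa [map_sum, Pi.single_apply] using this)
  set l : S4 := ∑ i, C (v i) * X i with hl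
  have hlh : l.IsHomogeneous 1 := by
    apply IsHomogeneous.sum
    intro i _
    exact (isHomogeneous_X ℂ i).C_mul _
  set J := jacIdeal f with hJ
  have hJH : HI J := HI_iSup _ hh
  have hrad : idealOfVars (Fin 4) ℂ ≤ (J ⊔ Ideal.span {l}).radical := by
    unfold idealOfVars
    rw [Ideal.span_le]
    rintro _ ⟨i, rfl⟩
    rw [SetLike.mem_coe]
    rw [← vanishingIdeal_zeroLocus_eq_radical (K := ℂ), mem_vanishingIdeal_iff]
    intro q hq
    rw [mem_zeroLocus_iff] at hq
    have h1 : ∀ i, eval q (pderiv i f) = 0 := fun i =>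
      hq _ (Ideal.mem_sup_left (Ideal.subset_span ⟨i, rfl⟩))
    have h2 : eval q l = 0 := hq _ (Ideal.mem_sup_right (Ideal.mem_span_singleton_self _))
    obtain ⟨p, hp, c, rfl⟩ := hL q h1
    rw [eval_hom hlh] at h2
    have h3 := hv p hp
    have h4 : eval p l = eval v (∑ i, C (p i) * X i) := by
      simp [hl, map_sum, mul_comm]
    rw [h4] at h2
    have h5 : c = 0 := by
      rcases mul_eq_zero.1 h2 with h | h
      · simpa using h
      · exact absurd h h3
    simp [h5]
  obtain ⟨n, hn⟩ := Ideal.exists_pow_le_of_le_radical_of_fg hrad (IsNoetherian.noetherian _)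
  have hz : ∀ k, n ≤ k → HF (J ⊔ Ideal.span {l}) k = 0 := by
    intro k hk
    have : Pk (J ⊔ Ideal.span {l}) k = Sk k := by
      apply inf_eq_left.2
      intro x hx
      apply hn
      rw [mem_pow_idealOfVars_iff']
      intro d hd
      by_contra h0
      have h9 := hx h0
      have : d.degree = k := by
        rw [Finsupp.degree_eq_weight_one]
        exact h9
      omega
    unfold HF
    rw [this]; simp
  have hanti : ∀ k, n ≤ k → hilb f (k + 1) ≤ hilb f k := by
    intro k hk
    have h1 := HF_colon hJH hlh k
    rw [hz _ (by omega)] at h1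
    have h2 : HF (cln J l) k ≤ HF J k := HF_anti (fun _ hm => J.mul_mem_left _ hm) k
    have h3 := hilb_eq_s6 f k
    have h4 := hilb_eq_s6 f (k + 1)
    rw [← hJ] at h3 h4
    omega
  have hanti2 : Antitone (fun k => hilb f (n + k)) := antitone_nat_of_succ_le (fun k => hanti _ (Nat.le_add_right n k))
  obtain ⟨m, hm⟩ := WellFoundedLT.antitone_chain_condition hanti2
  refine ⟨n + m, hilb f (n + m), ?_⟩
  intro k hk
  obtain ⟨j, rfl⟩ := Nat.exists_eq_add_of_le hk
  have := hm (m + j) (by omega)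
  rw [← add_assoc] at this
  exact this.symm

end P4

section P5

lemma avoidlin (Q : Ideal S4) (ρ : Fin 4 → S4) (h : ∃ i, ρ i ∉ Q) :
    ∃ φ : S4, φ ≠ 0 ∧ ∀ c : Fin 4 → ℂ, eval c φ ≠ 0 → ∑ i, C (c i) * ρ i ∉ Q := by
  let W : Submodule ℂ (Fin 4 → ℂ) :=
    { carrier := {c | ∑ i, C (c i) * ρ i ∈ Q}
      add_mem' := by
        intro a b ha hb
        have := Q.add_mem ha hb
        rw [← Finset.sum_add_distrib] at this
        change ∑ i, C ((a + b) i) * ρ i ∈ Q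
        simpa [add_mul] using this
      zero_mem' := by
        change ∑ i, C ((0 : Fin 4 → ℂ) i) * ρ i ∈ Q
        simp
      smul_mem' := by
        intro c x hx
        have := Q.mul_mem_left (C c) hx
        rw [Finset.mul_sum] at this
        change ∑ i, C ((c • x) i) * ρ i ∈ Q
        simpa [mul_assoc] using this }
  obtain ⟨i, hi⟩ := h
  have hW : W < ⊤ := by
    rw [lt_top_iff_ne_top]
    intro h
    apply hi
    have : Pi.single i (1 : ℂ) ∈ W := by rw [h]; trivial
    have h2 : ∑ k, C ((Pi.single i (1 : ℂ) : Fin 4 → ℂ) k) * ρ k ∈ Q := this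
    simpa [Pi.single_apply, apply_ite C, ite_mul] using h2
  obtain ⟨g, hg, hle⟩ := Submodule.exists_le_ker_of_lt_top W hW
  have key : ∀ c : Fin 4 → ℂ, eval c (∑ i, C (g (Pi.single i 1)) * X i : S4) = g c := by
    intro c
    rw [LinearMap.pi_apply_eq_sum_univ g c]
    simp [map_sum, mul_comm]
    congr! with x _ k
    rw [Pi.single_apply]
    simp [eq_comm]
  refine ⟨∑ i, C (g (Pi.single i 1)) * X i, ?_, ?_⟩
  · intro h0
    apply hg
    ext c
    have := key (Pi.single c 1)
    rw [h0] at this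
    simpa using this.symm
  · intro c hc hm
    rw [key] at hc
    exact hc (hle hm)

lemma lemB {f : S4} {D r : ℕ} (hh : ∀ i, (pderiv i f).IsHomogeneous D) (ρ : Fin 4 → S4)
    (hρ : ρ ≠ 0) (hs : isSyzygy f ρ) (hr : ∀ i, (ρ i).IsHomogeneous r)
    (hmin : ∀ k, k < r → ¬ hasSyzygyOfDeg f k) :
    ∃ j, ρ j ≠ 0 ∧ ∃ c : Fin 4 → ℂ, Rg (Ideal.span {ρ j}) (∑ i, C (c i) * ρ i) := by
  obtain ⟨j, hj⟩ := Function.ne_iff.1 hρ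
  have hj : ρ j ≠ 0 := hj
  refine ⟨j, hj, ?_⟩
  obtain ⟨T, hT, hT1, hT2⟩ := ass (Ideal.span {ρ j})
  have hex : ∀ Q ∈ T, ∃ i, ρ i ∉ Q := by
    intro Q hQ
    by_contra hc
    push Not at hc
    obtain ⟨_, m, hm, hmQ⟩ := hT1 Q hQ
    obtain ⟨b', m', g, hrel, e1, e2⟩ := UniqueFactorizationMonoid.exists_reduced_factors (ρ j) hj m
    have hdvd : ∀ i, b' ∣ ρ i := by
      intro i
      obtain ⟨w, hw⟩ := Ideal.mem_span_singleton.1 ((hmQ _).1 (hc i))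
      have hg : g ≠ 0 := by
        rintro rfl; apply hj; rw [← e1, zero_mul]
      have : ρ i * m' = b' * w := by
        apply mul_left_cancel₀ hg
        rw [← e1, ← e2] at hw
        linear_combination hw
      exact hrel.dvd_of_dvd_mul_right ⟨w, this⟩
    have hb0 : b' ≠ 0 := by
      rintro rfl; apply hj; rw [← e1, mul_zero]
    have hdeg : b'.totalDegree ≠ 0 := by
      intro h0
      apply hm
      rw [totalDegree_eq_zero_iff_eq_C] at h0
      have hc0 : coeff 0 b' ≠ 0 := by
        intro h; apply hb0; rw [h0, h, C_0]
      rw [Ideal.mem_span_singleton]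
      refine ⟨C (coeff 0 b')⁻¹ * m', ?_⟩
      rw [← e2, ← e1]
      have : b' * C (coeff 0 b')⁻¹ = 1 := by
        conv_lhs => rw [h0]
        rw [← C_mul]
        simp [hc0]
      linear_combination (-(g * m')) * this
    choose σ hσ using hdvd
    have hσj : σ j ≠ 0 := by
      intro h; apply hj; rw [hσ, h, mul_zero]
    have hsσ : ∑ i, σ i * pderiv i f = 0 := by
      apply mul_left_cancel₀ hb0
      rw [Finset.mul_sum, mul_zero, ← hs]
      apply Finset.sum_congr rfl
      intro i _
      conv_rhs => rw [hσ i]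
      ring
    have hlt : (σ j).totalDegree < r := by
      have h1 := (hr j).totalDegree hj
      conv_lhs at h1 => rw [hσ j]
      rw [totalDegree_mul_of_isDomain hb0 hσj] at h1
      omega
    apply hmin _ hlt
    refine ⟨fun i => homogeneousComponent (σ j).totalDegree (σ i), ?_, ?_, fun i =>
      homogeneousComponent_isHomogeneous _ _⟩
    · intro h
      have := congrFun h j
      obtain ⟨d, hd, hd2⟩ : ∃ d ∈ (σ j).support, (σ j).totalDegree = d.degree := by
        obtain ⟨d, hd, h⟩ := Finset.exists_mem_eq_sup (σ j).support
          (support_nonempty.2 hσj) (fun s => s.sum fun _ e => e)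
        exact ⟨d, hd, h⟩
      have h3 := congrArg (coeff d) this
      rw [coeff_homogeneousComponent, if_pos hd2.symm] at h3
      exact mem_support_iff.1 hd (by simpa using h3)
    · have := congrArg (homogeneousComponent ((σ j).totalDegree + D)) hsσ
      rw [map_sum, map_zero] at this
      unfold isSyzygy
      rw [← this]
      apply Finset.sum_congr rfl
      intro i _
      rw [mul_comm (σ i), hc_mul (hh i), mul_comm]
  choose! φ hφ0 hφ using fun Q (hQ : Q ∈ T) => avoidlin Q ρ (hex Q hQ)
  obtain ⟨c, hc⟩ := avoid hT.toFinset φ (by intro Q hQ; exact hφ0 Q (by simpa using hQ))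
  exact ⟨c, hT2 _ fun Q hQ => hφ Q hQ c (hc Q (by simpa using hQ))⟩

lemma lemF {r : ℕ} (ρ : Fin 4 → S4) (hρ : ρ ≠ 0) (hr : ∀ i, (ρ i).IsHomogeneous r) :
    ∃ H : S4, H ≠ 0 ∧ ∀ v : Fin 4 → ℂ, v ≠ 0 → eval v H ≠ 0 → ∃ L : Finset (Fin 4 → ℂ),
      (∀ p ∈ L, p ≠ 0) ∧ ∀ (q : Fin 4 → ℂ) (l : ℂ), l ≠ 0 → (∀ i, eval q (ρ i) = l * v i) →
        ∃ p ∈ L, ∃ c : ℂ, q = c • p := by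
  classical
  rcases Nat.eq_zero_or_pos r with rfl | hr0
  · have hw : ∀ i, ∃ w : ℂ, ρ i = C w := by
      intro i
      exact ⟨_, totalDegree_eq_zero_iff_eq_C.1 (Nat.le_zero.1 (hr i).totalDegree_le)⟩
    choose w hw using hw
    obtain ⟨j, hj⟩ := Function.ne_iff.1 hρ
    have hj : w j ≠ 0 := by
      intro h; apply hj; rw [hw, h, C_0]; rfl
    obtain ⟨i, hi⟩ : ∃ i : Fin 4, i ≠ j := exists_ne j
    refine ⟨C (w j) * X i - C (w i) * X j, ?_, ?_⟩
    · intro h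
      have := congrArg (eval (Pi.single i (1 : ℂ))) h
      simp [hi.symm, hj] at this
    · intro v _ hv
      refine ⟨∅, by simp, ?_⟩
      intro q l hl hq
      exfalso
      apply hv
      have h1 := hq i
      have h2 := hq j
      rw [hw, eval_C] at h1 h2
      simp only [map_sub, map_mul, eval_C, eval_X]
      rw [h1, h2]; ring
  · have hG : ∀ i : Fin 4, ∃ G : MvPolynomial (Option (Fin 4)) ℂ, G ≠ 0 ∧
        aeval (fun o : Option (Fin 4) => o.elim (X i) ρ) G = 0 := by
      intro i
      by_contra hc
      push Not at hc
      have hind : AlgebraicIndependent ℂ (fun o : Option (Fin 4) => o.elim (X i) ρ) := by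
        rw [algebraicIndependent_iff]
        intro p hp
        by_contra h
        exact hc p h hp
      have h1 := hind.lift_cardinalMk_le_trdeg
      rw [MvPolynomial.trdeg_of_isDomain] at h1
      simp at h1
      norm_num at h1
    choose G hG0 hG using hG
    have hG1 : ∀ i, optionEquivLeft ℂ (Fin 4) (G i) ≠ 0 := by
      intro i; simpa using hG0 i
    refine ⟨∏ i, (optionEquivLeft ℂ (Fin 4) (G i)).leadingCoeff, ?_, ?_⟩
    · exact Finset.prod_ne_zero_iff.2 fun i _ => Polynomial.leadingCoeff_ne_zero.2 (hG1 i)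
    · intro v hv0 hv
      rw [map_prod, Finset.prod_ne_zero_iff] at hv
      let P : Fin 4 → Polynomial ℂ := fun i =>
        Polynomial.map (eval v) (optionEquivLeft ℂ (Fin 4) (G i))
      have hP : ∀ i, P i ≠ 0 := by
        intro i h
        apply hv i (Finset.mem_univ _)
        have := congrArg (fun p => Polynomial.coeff p
          (optionEquivLeft ℂ (Fin 4) (G i)).natDegree) h
        simp only [P, Polynomial.coeff_map, Polynomial.coeff_zero] at this
        exact this
      refine ⟨(Fintype.piFinset fun i => (P i).roots.toFinset).filter (· ≠ 0), ?_, ?_⟩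
      · intro p hp; exact (Finset.mem_filter.1 hp).2
      · intro q l hl hq
        obtain ⟨μ, hμ⟩ := IsAlgClosed.exists_pow_nat_eq (l⁻¹) hr0
        have hμ0 : μ ≠ 0 := by
          rintro rfl
          rw [zero_pow hr0.ne'] at hμ
          exact inv_ne_zero hl hμ.symm
        have hq' : ∀ i, eval (μ • q) (ρ i) = v i := by
          intro i
          rw [eval_hom (hr i), hμ, hq, ← mul_assoc, inv_mul_cancel₀ hl, one_mul]
        refine ⟨μ • q, ?_, μ⁻¹, by rw [smul_smul, inv_mul_cancel₀ hμ0, one_smul]⟩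
        rw [Finset.mem_filter, Fintype.mem_piFinset]
        constructor
        · intro i
          rw [Multiset.mem_toFinset, Polynomial.mem_roots (hP i), Polynomial.IsRoot.def]
          have h1 := optionEquivLeft_elim_eval ℂ (Fin 4) v ((μ • q) i) (G i)
          rw [← h1]
          have h2 := congrArg (aeval (R := ℂ) (μ • q)) (hG i)
          rw [map_zero, ← AlgHom.comp_apply, comp_aeval] at h2
          rw [← h2]
          change aeval _ (G i) = _
          congr 2
          ext o
          cases o with
          | none => simp
          | some k => exact (hq' k).symm
        · intro h0
          apply hv0
          ext i
          rw [← hq' i, h0]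
          have := eval_hom (hr i) 0 0
          rw [smul_zero, zero_pow hr0.ne', zero_mul] at this
          exact this

end P5

section P6

lemma exists_St {f : S4} {D r : ℕ} (hh : ∀ i, (pderiv i f).IsHomogeneous D)
    (hne : ∃ i, pderiv i f ≠ 0) (hiso : (singLocus f).Finite)
    (hd1 : hasSyzygyOfDeg f r) (hmin : ∀ k, k < r → ¬ hasSyzygyOfDeg f k) :
    ∃ f0 f1 f2 f3 a0 a1 a2 a3, St (jacIdeal f) D r f0 f1 f2 f3 a0 a1 a2 a3 := by
  obtain ⟨ρ, hρ0, hs, hr⟩ := hd1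
  obtain ⟨j, hj, c, hc⟩ := lemB hh ρ hρ0 hs hr hmin
  obtain ⟨L, -, hL0, hL⟩ := singL hh hiso
  have HJ : ∀ Q : Ideal S4, Q.IsPrime → (∀ i, pderiv i f ∈ Q) → Good Q := by
    intro Q hQ hi
    obtain ⟨p, hp, h⟩ := lemN (jacIdeal f) Q hQ (by
        unfold jacIdeal; rw [Ideal.span_le]; rintro _ ⟨i, rfl⟩; exact hi i)
      (g := 1) (fun h => hQ.ne_top ((Ideal.eq_top_iff_one _).2 h)) L (by
        intro q hq
        exact Or.inr (hL q fun i => hq _ (Ideal.subset_span ⟨i, rfl⟩)))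
    exact good_lin Q p (hL0 p hp) h
  obtain ⟨H, hH0, hH⟩ := lemF ρ hρ0 hr
  obtain ⟨T, hT, hT1, hT2⟩ := ass3 hj hc
  have hex : ∀ Q ∈ T, ∃ i, pderiv i f ∉ Q := by
    intro Q hQ
    by_contra hcon
    push Not at hcon
    exact (hT1 Q hQ).2.2.2 (HJ Q (hT1 Q hQ).1 hcon)
  choose! φ hφ0 hφ using fun Q (hQ : Q ∈ T) => avoidlin Q (fun i => pderiv i f) (hex Q hQ)
  obtain ⟨ψ, hψ0, hψ⟩ := avoidlin ⊥ (fun i => pderiv i f) (by simpa using hne)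
  obtain ⟨v, hv⟩ := avoid (Finset.univ : Finset (Fin 1))
    (fun _ => X 1 * H * ψ * ∏ Q ∈ hT.toFinset, φ Q) (by
      intro _ _
      refine mul_ne_zero (mul_ne_zero (mul_ne_zero (X_ne_zero _) hH0) hψ0)
        (Finset.prod_ne_zero_iff.2 fun Q hQ => hφ0 Q (by simpa using hQ)))
  have hv := hv 0 (Finset.mem_univ _)
  rw [map_mul, map_mul, map_mul, eval_X, map_prod] at hv
  have hv4 := Finset.prod_ne_zero_iff.1 (right_ne_zero_of_mul hv)
  have hv3 := right_ne_zero_of_mul (left_ne_zero_of_mul hv)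
  have hv2 := right_ne_zero_of_mul (left_ne_zero_of_mul (left_ne_zero_of_mul hv))
  have hv1 := left_ne_zero_of_mul (left_ne_zero_of_mul (left_ne_zero_of_mul hv))
  have hf1 := hψ v hv3
  rw [Ideal.mem_bot] at hf1
  have hreg := hT2 (∑ i, C (v i) * pderiv i f) (fun Q hQ => hφ Q hQ v (hv4 Q (by simpa using hQ)))
  obtain ⟨L', hL'0, hL'⟩ := hH v (by rintro rfl; exact hv1 rfl) hv2
  have hw1 : (C (v 1)⁻¹ * C (v 1) : S4) = 1 := by
    rw [← C_mul, inv_mul_cancel₀ hv1, C_1]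
  set w : S4 := C (v 1)⁻¹ with hw
  have hs' : ρ 0 * pderiv 0 f + ρ 1 * pderiv 1 f + ρ 2 * pderiv 2 f + ρ 3 * pderiv 3 f = 0 := by
    have := hs
    unfold isSyzygy at this
    simpa [Fin.sum_univ_four] using this
  have hf1' : ∑ i, C (v i) * pderiv i f = C (v 0) * pderiv 0 f + C (v 1) * pderiv 1 f +
    C (v 2) * pderiv 2 f + C (v 3) * pderiv 3 f := by rw [Fin.sum_univ_four]
  have hhom : ∀ i, (ρ i - w * C (v i) * ρ 1).IsHomogeneous r := by
    intro i
    rw [hw, ← C_mul]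
    exact (hr i).sub ((hr 1).C_mul _)
  refine ⟨pderiv 0 f, ∑ i, C (v i) * pderiv i f, pderiv 2 f, pderiv 3 f,
    ρ 0 - w * C (v 0) * ρ 1, w * ρ 1, ρ 2 - w * C (v 2) * ρ 1, ρ 3 - w * C (v 3) * ρ 1,
    hh 0, ?_, hh 2, hh 3, hhom 0, (hr 1).C_mul _, hhom 2, hhom 3, ?_, ?_, hf1, ?_, ?_⟩
  · exact IsHomogeneous.sum _ _ _ fun i _ => (hh i).C_mul _
  · rw [hf1']
    linear_combination hs' + ρ 1 * pderiv 1 f * hw1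
  · rw [hf1']
    unfold jacIdeal
    apply le_antisymm
    · rw [Ideal.span_le]
      set K : Ideal S4 := Ideal.span {pderiv 0 f, C (v 0) * pderiv 0 f + C (v 1) * pderiv 1 f +
        C (v 2) * pderiv 2 f + C (v 3) * pderiv 3 f, pderiv 2 f, pderiv 3 f} with hK
      have k0 : pderiv 0 f ∈ K := Ideal.subset_span (by simp)
      have k1 : C (v 0) * pderiv 0 f + C (v 1) * pderiv 1 f +
        C (v 2) * pderiv 2 f + C (v 3) * pderiv 3 f ∈ K := Ideal.subset_span (by simp)
      have k2 : pderiv 2 f ∈ K := Ideal.subset_span (by simp)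
      have k3 : pderiv 3 f ∈ K := Ideal.subset_span (by simp)
      rintro _ ⟨i, rfl⟩
      fin_cases i
      · exact k0
      · have : pderiv 1 f = w * (C (v 0) * pderiv 0 f + C (v 1) * pderiv 1 f +
          C (v 2) * pderiv 2 f + C (v 3) * pderiv 3 f) - w * C (v 0) * pderiv 0 f -
          w * C (v 2) * pderiv 2 f - w * C (v 3) * pderiv 3 f := by
          linear_combination (-pderiv 1 f) * hw1
        change pderiv 1 f ∈ K
        rw [this]
        exact K.sub_mem (K.sub_mem (K.sub_mem (K.mul_mem_left _ k1) (K.mul_mem_left _ k0))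
          (K.mul_mem_left _ k2)) (K.mul_mem_left _ k3)
      · exact k2
      · exact k3
    · rw [Ideal.span_le]
      have hm : ∀ i, pderiv i f ∈ Ideal.span (Set.range fun i => pderiv i f) := fun i =>
        Ideal.subset_span ⟨i, rfl⟩
      rintro x hx
      simp only [Set.mem_insert_iff, Set.mem_singleton_iff] at hx
      rcases hx with rfl | rfl | rfl | rfl
      · exact hm 0
      · exact Ideal.add_mem _ (Ideal.add_mem _ (Ideal.add_mem _ (Ideal.mul_mem_left _ _ (hm 0))
          (Ideal.mul_mem_left _ _ (hm 1))) (Ideal.mul_mem_left _ _ (hm 2)))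
          (Ideal.mul_mem_left _ _ (hm 3))
      · exact hm 2
      · exact hm 3
  · intro Q hQ h0 h1 h2 h3
    rw [hf1'] at h1
    apply HJ Q hQ
    intro i
    fin_cases i
    · exact h0
    · have : pderiv 1 f = w * (C (v 0) * pderiv 0 f + C (v 1) * pderiv 1 f +
          C (v 2) * pderiv 2 f + C (v 3) * pderiv 3 f) - w * C (v 0) * pderiv 0 f -
          w * C (v 2) * pderiv 2 f - w * C (v 3) * pderiv 3 f := by
          linear_combination (-pderiv 1 f) * hw1
      change pderiv 1 f ∈ Q
      rw [this]
      exact Q.sub_mem (Q.sub_mem (Q.sub_mem (Q.mul_mem_left _ h1) (Q.mul_mem_left _ h0))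
          (Q.mul_mem_left _ h2)) (Q.mul_mem_left _ h3)
    · exact h2
    · exact h3
  · intro Q hQ h0 h2 h3 hF
    by_cases h1 : ρ 1 ∈ Q
    · have hall : ∀ i, ρ i ∈ Q := by
        have key : ∀ i, ρ i - w * C (v i) * ρ 1 ∈ Q → ρ i ∈ Q := by
          intro i hi
          have := Q.add_mem hi (Q.mul_mem_left (w * C (v i)) h1)
          simpa using this
        intro i
        fin_cases i
        · exact key 0 h0
        · exact h1
        · exact key 2 h2
        · exact key 3 h3
      exact ⟨ρ j, hall j, ∑ i, C (c i) * ρ i, Q.sum_mem fun i _ => Q.mul_mem_left _ (hall i),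
        _, hF, hj, hc, hreg⟩
    · obtain ⟨p, hp, h⟩ := lemN (Ideal.span {ρ 0 - w * C (v 0) * ρ 1, ρ 2 - w * C (v 2) * ρ 1,
          ρ 3 - w * C (v 3) * ρ 1}) Q hQ (by
          rw [Ideal.span_le]
          intro x hx
          simp only [Set.mem_insert_iff, Set.mem_singleton_iff] at hx
          rcases hx with rfl | rfl | rfl <;> assumption) h1 L' (by
          intro q hq
          by_cases hq1 : eval q (ρ 1) = 0
          · exact Or.inl hq1
          right
          apply hL' q ((v 1)⁻¹ * eval q (ρ 1)) (mul_ne_zero (inv_ne_zero hv1) hq1)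
          have key : ∀ i, eval q (ρ i - w * C (v i) * ρ 1) = 0 →
              eval q (ρ i) = (v 1)⁻¹ * eval q (ρ 1) * v i := by
            intro i hi
            simp only [hw, map_sub, map_mul, eval_C] at hi
            linear_combination hi
          intro i
          fin_cases i
          · exact key 0 (hq _ (Ideal.subset_span (by simp)))
          · change eval q (ρ 1) = (v 1)⁻¹ * eval q (ρ 1) * v 1
            field_simp
          · exact key 2 (hq _ (Ideal.subset_span (by simp)))
          · exact key 3 (hq _ (Ideal.subset_span (by simp))))
      exact good_lin Q p (hL'0 p hp) h

end P6

/-- du Plessis–Wall: for a reduced surface `X : f = 0` of degree `d ≥ 3`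
with at most isolated singularities, and `d₁ = min{k : AR(f)ₖ ≠ 0}`, the total Tjurina number
(the eventual constant value of the Hilbert function of `M(f)`) satisfies
`(d−1)³ − d₁(d−1)² ≤ τ(X) ≤ (d−1)³ − d₁(d−d₁−1)(d−1)`. -/
theorem stmt6 (f : S4) (d : ℕ) (hd : 3 ≤ d) (hhom : f.IsHomogeneous d) (hred : Squarefree f)
    (hiso : (singLocus f).Finite)
    (d1 : ℕ) (hd1 : hasSyzygyOfDeg f d1) (hd1min : ∀ k, k < d1 → ¬ hasSyzygyOfDeg f k) :
    ∃ (τ : ℕ) (N : ℕ), (∀ k, N ≤ k → hilb f k = τ) ∧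
      ((d : ℤ) - 1) ^ 3 - (d1 : ℤ) * ((d : ℤ) - 1) ^ 2 ≤ (τ : ℤ) ∧
      (τ : ℤ) ≤ ((d : ℤ) - 1) ^ 3 - (d1 : ℤ) * ((d : ℤ) - (d1 : ℤ) - 1) * ((d : ℤ) - 1) := by
  have hh : ∀ i, (pderiv i f).IsHomogeneous (d - 1) := fun i => hhom.pderiv
  have hne : ∃ i, pderiv i f ≠ 0 := by
    by_contra hc
    push Not at hc
    have h1 := hhom.sum_X_mul_pderiv
    simp only [hc, mul_zero, Finset.sum_const_zero] at h1
    have h2 : f = 0 := by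
      rcases smul_eq_zero.1 h1.symm with h | h
      · omega
      · exact h
    exact hred.ne_zero h2
  obtain ⟨f0, f1, f2, f3, a0, a1, a2, a3, hSt⟩ := exists_St hh hne hiso hd1 hd1min
  obtain ⟨N, τ, hN⟩ := event_const hh hiso
  refine ⟨τ, N, hN, ?_⟩
  have hb := bounds hSt (N + 4 * (d - 1) + d1) (by omega)
  rw [← hilb_eq_s6, hN _ (by omega)] at hb
  obtain ⟨e, rfl⟩ : ∃ e, d = e + 1 := ⟨d - 1, by omega⟩
  simp only [Nat.add_sub_cancel] at hb
  push_cast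
  constructor
  · linarith [hb.1]
  · linarith [hb.2]
end
end
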